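/- arXiv:math/0410304 — 3 statements merged into one kernel-verified Lean document; each statement's English description precedes it below -/
import Mathlib

section
/- Let (R,P) be a commutative Noetherian local ring, I and J ideals of R, M and N finitely generated R-modules, and i ≥ 0. Assume that M ⊗_R N has finite length. Then length_R(Tor_i^R(M/I^n M, N/J^m N)) is eventually given by a polynomial in m and n. -/
open CategoryTheory IsLocalRing

/-- `Tor_i^R(M, N)` as an object of `ModuleCat R`. -/
noncomputable def TorM (R : Type) [CommRing R] (i : ℕ)
    (M : Type) [AddCommGroup M] [Module R M]
    (N : Type) [AddCommGroup N] [Module R N] : ModuleCat R :=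
  ((Tor (ModuleCat R) i).obj (ModuleCat.of R M)).obj (ModuleCat.of R N)

/-- The length of a module: the Krull dimension of its lattice of submodules. -/
noncomputable def modLength (R : Type) [CommRing R]
    (M : Type) [AddCommGroup M] [Module R M] : WithBot ℕ∞ :=
  Order.krullDim (Submodule R M)

/-- `f (m, n)` is eventually given by a polynomial in `m` and `n`. -/
def EventuallyPolynomial₂ (f : ℕ → ℕ → WithBot ℕ∞) : Prop :=
  ∃ (p : MvPolynomial (Fin 2) ℚ) (m₀ n₀ : ℕ), ∀ m, m₀ ≤ m → ∀ n, n₀ ≤ n →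
    ∃ c : ℕ, f m n = (c : ℕ∞) ∧ (c : ℚ) = MvPolynomial.eval ![(m : ℚ), (n : ℚ)] p

section RelLength

variable {R : Type*} [CommRing R] {E : Type*} [AddCommGroup E] [Module R E]
  {E' : Type*} [AddCommGroup E'] [Module R E']

/-- The length of the subquotient `Z / (D ∩ Z)`. -/
noncomputable def relLength (D Z : Submodule R E) : ℕ∞ :=
  Module.length R (Z ⧸ D.submoduleOf Z)

theorem relLength_congr {D Z : Submodule R E} {D' Z' : Submodule R E'} (g : E →ₗ[R] E')
    (h₁ : ∀ z ∈ Z, g z ∈ Z') (h₂ : ∀ z' ∈ Z', ∃ z ∈ Z, z' - g z ∈ D')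
    (h₃ : ∀ z ∈ Z, g z ∈ D' ↔ z ∈ D) : relLength D Z = relLength D' Z' := by
  let φ : Z →ₗ[R] Z' ⧸ D'.submoduleOf Z' := (D'.submoduleOf Z').mkQ ∘ₗ g.restrict h₁
  have hker : LinearMap.ker φ = D.submoduleOf Z := by
    ext z
    simp only [φ, LinearMap.mem_ker, LinearMap.comp_apply, Submodule.mkQ_apply,
      Submodule.Quotient.mk_eq_zero]
    exact h₃ z z.2
  have hsurj : Function.Surjective φ := by
    intro w
    obtain ⟨z', rfl⟩ := Submodule.Quotient.mk_surjective _ w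
    obtain ⟨z, hz, h⟩ := h₂ z' z'.2
    refine ⟨⟨z, hz⟩, ?_⟩
    have : z' - g.restrict h₁ ⟨z, hz⟩ ∈ D'.submoduleOf Z' := h
    exact ((Submodule.Quotient.eq _).2 this).symm
  exact ((Submodule.quotEquivOfEq _ _ hker.symm).trans
    (φ.quotKerEquivOfSurjective hsurj)).length_eq

theorem relLength_add {D W Z : Submodule R E} (h₁ : D ≤ W) (h₂ : W ≤ Z) :
    relLength D Z = relLength D W + relLength W Z := by
  have key : D.submoduleOf W = (D.submoduleOf Z).comap (Submodule.inclusion h₂) := rfl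
  refine Module.length_eq_add_of_exact
    ((D.submoduleOf W).mapQ (D.submoduleOf Z) (Submodule.inclusion h₂) key.le)
    ((D.submoduleOf Z).mapQ (W.submoduleOf Z) LinearMap.id
      (fun z hz => h₁ hz)) ?_ ?_ ?_
  · rw [← LinearMap.ker_eq_bot, Submodule.mapQ, Submodule.ker_liftQ_eq_bot]
    intro z hz
    simpa [key] using hz
  · intro w
    obtain ⟨z, rfl⟩ := Submodule.Quotient.mk_surjective _ w
    exact ⟨Submodule.Quotient.mk z, rfl⟩
  · intro w
    obtain ⟨z, rfl⟩ := Submodule.Quotient.mk_surjective _ w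
    constructor
    · intro h
      have hz : (z : E) ∈ W := (Submodule.Quotient.mk_eq_zero (W.submoduleOf Z)).1 h
      exact ⟨Submodule.Quotient.mk ⟨z, hz⟩, rfl⟩
    · rintro ⟨v, hv⟩
      obtain ⟨y, rfl⟩ := Submodule.Quotient.mk_surjective _ v
      rw [← hv]
      exact (Submodule.Quotient.mk_eq_zero _).2 y.2

theorem relLength_self (D : Submodule R E) : relLength D D = 0 := by
  have : D.submoduleOf D = ⊤ := by simp
  rw [relLength, this]
  exact Module.length_eq_zero

end RelLength

section StableFamilies

variable {R : Type*} [CommRing R] {E : Type*} [AddCommGroup E] [Module R E]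

/-- A doubly indexed family of submodules is stable if the operators in `s` raise the first index
by one, and the operators in `t` raise the second index by one. -/
def IsStableFamily (s t : List (Module.End R E)) (C : ℕ → ℕ → Submodule R E) : Prop :=
  (∀ x ∈ s, ∀ n m, (C n m).map x ≤ C (n + 1) m) ∧ ∀ y ∈ t, ∀ n m, (C n m).map y ≤ C n (m + 1)

/-- Modulo `B`, the family `C` is generated in bounded bidegree. -/
def IsBoundedlyGenerated (s t : List (Module.End R E)) (B C : ℕ → ℕ → Submodule R E) : Prop :=
  ∃ k, (∀ n m, k ≤ n → C (n + 1) m ≤ B (n + 1) m ⊔ ⨆ x ∈ s, (C n m).map x) ∧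
    ∀ n m, k ≤ m → C n (m + 1) ≤ B n (m + 1) ⊔ ⨆ y ∈ t, (C n m).map y

/-- Every stable family between `B` and `A` is generated in bounded bidegree modulo `B`. -/
def IsNoetherianPair (s t : List (Module.End R E)) (B A : ℕ → ℕ → Submodule R E) : Prop :=
  ∀ C, IsStableFamily s t C → B ≤ C → C ≤ A → IsBoundedlyGenerated s t B C

/-- The data to which the Hilbert polynomial theorem applies: a pair `B ≤ A` of stable families,
Noetherian, with subquotients of finite length. -/
structure IsHilbertPair (s t : List (Module.End R E)) (B A : ℕ → ℕ → Submodule R E) : Prop where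
  commute : ∀ x ∈ s ++ t, ∀ y ∈ s ++ t, Commute x y
  stable_left : IsStableFamily s t B
  stable_right : IsStableFamily s t A
  le : B ≤ A
  finite : ∀ n m, relLength (B n m) (A n m) ≠ ⊤
  noetherian : IsNoetherianPair s t B A

variable {s t : List (Module.End R E)} {B A C : ℕ → ℕ → Submodule R E}

theorem IsStableFamily.swap (h : IsStableFamily s t C) :
    IsStableFamily t s (fun n m => C m n) :=
  ⟨fun y hy n m => h.2 y hy m n, fun x hx n m => h.1 x hx m n⟩

theorem IsBoundedlyGenerated.swap (h : IsBoundedlyGenerated s t B C) :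
    IsBoundedlyGenerated t s (fun n m => B m n) (fun n m => C m n) :=
  let ⟨k, h₁, h₂⟩ := h
  ⟨k, fun n m hn => h₂ m n hn, fun n m hm => h₁ m n hm⟩

theorem IsNoetherianPair.swap (h : IsNoetherianPair s t B A) :
    IsNoetherianPair t s (fun n m => B m n) (fun n m => A m n) :=
  fun C hC h₁ h₂ => (h (fun n m => C m n) hC.swap (fun n m => h₁ m n) fun n m => h₂ m n).swap

theorem IsHilbertPair.swap (h : IsHilbertPair s t B A) :
    IsHilbertPair t s (fun n m => B m n) (fun n m => A m n) where
  commute x hx y hy := h.commute x (by simpa [or_comm] using hx) y (by simpa [or_comm] using hy)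
  stable_left := h.stable_left.swap
  stable_right := h.stable_right.swap
  le n m := h.le m n
  finite n m := h.finite m n
  noetherian := h.noetherian.swap

variable {x : Module.End R E}

theorem IsHilbertPair.kernel (h : IsHilbertPair (x :: s) t B A) :
    IsHilbertPair s t B (fun n m => A n m ⊓ (B (n + 1) m).comap x) where
  commute y hy z hz := h.commute y (List.mem_cons_of_mem _ hy) z (List.mem_cons_of_mem _ hz)
  stable_left := ⟨fun y hy n m => h.stable_left.1 y (List.mem_cons_of_mem _ hy) n m,
    h.stable_left.2⟩
  stable_right := by
    have comm : ∀ y ∈ s ++ t, ∀ v, x (y v) = y (x v) := fun y hy v =>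
      LinearMap.congr_fun (h.commute x (by simp) y (List.mem_cons_of_mem _ hy)).eq v
    constructor
    · rintro y hy n m _ ⟨v, hv, rfl⟩
      refine ⟨h.stable_right.1 y (List.mem_cons_of_mem _ hy) n m ⟨v, hv.1, rfl⟩, ?_⟩
      change x (y v) ∈ B (n + 1 + 1) m
      rw [comm y (List.mem_append_left _ hy)]
      exact h.stable_left.1 y (List.mem_cons_of_mem _ hy) _ m ⟨x v, hv.2, rfl⟩
    · rintro y hy n m _ ⟨v, hv, rfl⟩
      refine ⟨h.stable_right.2 y hy n m ⟨v, hv.1, rfl⟩, ?_⟩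
      change x (y v) ∈ B (n + 1) (m + 1)
      rw [comm y (List.mem_append_right _ hy)]
      exact h.stable_left.2 y hy _ m ⟨x v, hv.2, rfl⟩
  le n m v hv := ⟨h.le n m hv, h.stable_left.1 x (by simp) n m ⟨v, hv, rfl⟩⟩
  finite n m hT := by
    refine h.finite n m ?_
    rw [relLength_add (W := A n m ⊓ (B (n + 1) m).comap x) ?_ inf_le_left, hT, top_add]
    exact fun v hv => ⟨h.le n m hv, h.stable_left.1 x (by simp) n m ⟨v, hv, rfl⟩⟩
  noetherian := by
    intro C hC h₁ h₂
    have hx : ∀ n m, (C n m).map x ≤ B (n + 1) m := by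
      rintro n m _ ⟨v, hv, rfl⟩
      exact (h₂ n m hv).2
    obtain ⟨k, h₃, h₄⟩ := h.noetherian C
      ⟨fun y hy n m => by
        rcases List.mem_cons.1 hy with rfl | hy
        · exact (hx n m).trans (h₁ _ _)
        · exact hC.1 y hy n m, hC.2⟩ h₁ (fun n m => (h₂ n m).trans inf_le_left)
    refine ⟨k, fun n m hn => (h₃ n m hn).trans (sup_le le_sup_left (iSup₂_le fun y hy => ?_)), h₄⟩
    rcases List.mem_cons.1 hy with rfl | hy
    · exact (hx n m).trans le_sup_left
    · exact le_sup_of_le_right (le_iSup₂_of_le (f := fun x (_ : x ∈ s) => (C n m).map x)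
        y hy le_rfl)

theorem IsHilbertPair.cokernel (h : IsHilbertPair (x :: s) t B A) :
    IsHilbertPair s t (fun n m => B (n + 1) m ⊔ (A n m).map x) (fun n m => A (n + 1) m) where
  commute y hy z hz := h.commute y (List.mem_cons_of_mem _ hy) z (List.mem_cons_of_mem _ hz)
  stable_left := by
    have comm : ∀ y ∈ s ++ t, ∀ v, y (x v) = x (y v) := fun y hy v =>
      (LinearMap.congr_fun (h.commute x (by simp) y (List.mem_cons_of_mem _ hy)).eq v).symm
    constructor
    · intro y hy n m
      rw [Submodule.map_sup]
      refine sup_le ((h.stable_left.1 y (List.mem_cons_of_mem _ hy) _ m).trans le_sup_left) ?_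
      rintro _ ⟨_, ⟨v, hv, rfl⟩, rfl⟩
      rw [comm y (List.mem_append_left _ hy)]
      exact Submodule.mem_sup_right
        ⟨y v, h.stable_right.1 y (List.mem_cons_of_mem _ hy) n m ⟨v, hv, rfl⟩, rfl⟩
    · intro y hy n m
      rw [Submodule.map_sup]
      refine sup_le ((h.stable_left.2 y hy _ m).trans le_sup_left) ?_
      rintro _ ⟨_, ⟨v, hv, rfl⟩, rfl⟩
      rw [comm y (List.mem_append_right _ hy)]
      exact Submodule.mem_sup_right ⟨y v, h.stable_right.2 y hy n m ⟨v, hv, rfl⟩, rfl⟩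
  stable_right := ⟨fun y hy n m => h.stable_right.1 y (List.mem_cons_of_mem _ hy) (n + 1) m,
    fun y hy n m => h.stable_right.2 y hy (n + 1) m⟩
  le n m := sup_le (h.le _ _) (h.stable_right.1 x (by simp) n m)
  finite n m hT := by
    refine h.finite (n + 1) m ?_
    rw [relLength_add (W := B (n + 1) m ⊔ (A n m).map x) le_sup_left
      (sup_le (h.le _ _) (h.stable_right.1 x (by simp) n m)), hT, add_top]
  noetherian := by
    intro C hC h₁ h₂
    let C' : ℕ → ℕ → Submodule R E := fun n m => Nat.casesOn n (B 0 m) fun n => C n m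
    obtain ⟨k, h₃, h₄⟩ := h.noetherian C' (by
      constructor
      · rintro y hy (_ | n) m
        · exact (h.stable_left.1 y hy 0 m).trans (le_sup_left.trans (h₁ 0 m))
        · rcases List.mem_cons.1 hy with rfl | hy
          · exact (Submodule.map_mono (h₂ n m)).trans (le_sup_right.trans (h₁ (n + 1) m))
          · exact hC.1 y hy n m
      · rintro y hy (_ | n) m
        · exact h.stable_left.2 y hy 0 m
        · exact hC.2 y hy n m)
      (by
        rintro (_ | n) m
        · exact le_rfl
        · exact le_sup_left.trans (h₁ n m))
      (by
        rintro (_ | n) m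
        · exact h.le 0 m
        · exact h₂ n m)
    refine ⟨k, fun n m hn => (h₃ (n + 1) m (by lia)).trans
      (sup_le (le_sup_left.trans le_sup_left) (iSup₂_le fun y hy => ?_)),
      fun n m hm => (h₄ (n + 1) m hm).trans (sup_le_sup_right le_sup_left _)⟩
    rcases List.mem_cons.1 hy with rfl | hy
    · exact (Submodule.map_mono (h₂ n m)).trans (le_sup_right.trans le_sup_left)
    · exact le_sup_of_le_right (le_iSup₂_of_le (f := fun x (_ : x ∈ s) => (C n m).map x)
        y hy le_rfl)

theorem IsHilbertPair.relLength_succ (h : IsHilbertPair (x :: s) t B A) (n m : ℕ) :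
    relLength (B (n + 1) m) (A (n + 1) m) + relLength (B n m) (A n m ⊓ (B (n + 1) m).comap x) =
      relLength (B n m) (A n m) + relLength (B (n + 1) m ⊔ (A n m).map x) (A (n + 1) m) := by
  rw [relLength_add (D := B n m) (Z := A n m) (h.kernel.le n m) inf_le_left,
    relLength_add (D := B (n + 1) m) (Z := A (n + 1) m) le_sup_left (h.cokernel.le n m)]
  have : relLength (A n m ⊓ (B (n + 1) m).comap x) (A n m) =
      relLength (B (n + 1) m) (B (n + 1) m ⊔ (A n m).map x) := by
    refine relLength_congr x (fun z hz => Submodule.mem_sup_right ⟨z, hz, rfl⟩) ?_ ?_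
    · intro z' hz'
      obtain ⟨b, hb, _, ⟨z, hz, rfl⟩, rfl⟩ := Submodule.mem_sup.1 hz'
      exact ⟨z, hz, by simpa using hb⟩
    · exact fun z hz => ⟨fun h => ⟨hz, h⟩, fun h => h.2⟩
  rw [this]
  ring

theorem IsHilbertPair.exists_relLength_eq_zero (h : IsHilbertPair [] t B A) :
    ∃ k, ∀ n m, k ≤ n → relLength (B n m) (A n m) = 0 := by
  obtain ⟨k, h₁, -⟩ := h.noetherian A h.stable_right h.le le_rfl
  refine ⟨k + 1, fun n m hn => ?_⟩
  obtain ⟨n, rfl⟩ : ∃ l, n = l + 1 := ⟨n - 1, by lia⟩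
  have := h₁ n m (by lia)
  simp only [List.not_mem_nil, iSup_false, iSup_bot, sup_bot_eq] at this
  rw [le_antisymm this (h.le _ _)]
  exact relLength_self _

end StableFamilies

section EventuallyPolynomial

/-- The function `f` agrees with a polynomial for all sufficiently large arguments. -/
def AgreesWithPolynomial (f : ℕ → ℕ → ℚ) : Prop :=
  ∃ (p : MvPolynomial (Fin 2) ℚ) (k : ℕ), ∀ n m, k ≤ n → k ≤ m →
    f n m = MvPolynomial.eval ![(n : ℚ), (m : ℚ)] p

namespace AgreesWithPolynomial

variable {f g : ℕ → ℕ → ℚ}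

theorem of_eventually_eq (hf : AgreesWithPolynomial f) (k : ℕ)
    (h : ∀ n m, k ≤ n → k ≤ m → g n m = f n m) : AgreesWithPolynomial g := by
  obtain ⟨p, l, hp⟩ := hf
  exact ⟨p, max k l, fun n m hn hm => by
    rw [h n m (by lia) (by lia), hp n m (by lia) (by lia)]⟩

theorem const (c : ℚ) : AgreesWithPolynomial fun _ _ => c :=
  ⟨MvPolynomial.C c, 0, by simp⟩

theorem add (hf : AgreesWithPolynomial f) (hg : AgreesWithPolynomial g) :
    AgreesWithPolynomial fun n m => f n m + g n m := by
  obtain ⟨p, k, hp⟩ := hf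
  obtain ⟨q, l, hq⟩ := hg
  exact ⟨p + q, max k l, fun n m hn hm => by
    beta_reduce
    rw [hp n m (by lia) (by lia), hq n m (by lia) (by lia), map_add]⟩

theorem sub (hf : AgreesWithPolynomial f) (hg : AgreesWithPolynomial g) :
    AgreesWithPolynomial fun n m => f n m - g n m := by
  obtain ⟨p, k, hp⟩ := hf
  obtain ⟨q, l, hq⟩ := hg
  exact ⟨p - q, max k l, fun n m hn hm => by
    beta_reduce
    rw [hp n m (by lia) (by lia), hq n m (by lia) (by lia), map_sub]⟩

theorem swap (hf : AgreesWithPolynomial f) : AgreesWithPolynomial fun n m => f m n := by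
  obtain ⟨p, k, hp⟩ := hf
  refine ⟨MvPolynomial.rename ![1, 0] p, k, fun n m hn hm => ?_⟩
  beta_reduce
  rw [hp m n hm hn, MvPolynomial.eval_rename]
  congr 2
  ext i
  fin_cases i <;> rfl

theorem slice (hf : AgreesWithPolynomial f) :
    ∃ k, ∀ l, k ≤ l → AgreesWithPolynomial fun n _ => f n l := by
  obtain ⟨p, k, hp⟩ := hf
  refine ⟨k, fun l hl => ⟨MvPolynomial.bind₁ ![MvPolynomial.X 0, MvPolynomial.C (l : ℚ)] p, k,
    fun n m hn hm => ?_⟩⟩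
  beta_reduce
  rw [hp n l hn hl, ← MvPolynomial.coe_aeval_eq_eval, ← MvPolynomial.coe_aeval_eq_eval]
  simp only [RingHom.coe_coe, MvPolynomial.aeval_bind₁]
  congr 2
  ext i
  fin_cases i <;> simp

theorem exists_antidifference (p : MvPolynomial (Fin 2) ℚ) :
    ∃ q : MvPolynomial (Fin 2) ℚ, ∀ n m : ℕ,
      MvPolynomial.eval ![((n + 1 : ℕ) : ℚ), (m : ℚ)] q - MvPolynomial.eval ![(n : ℚ), (m : ℚ)] q =
        MvPolynomial.eval ![(n : ℚ), (m : ℚ)] p := by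
  induction p using MvPolynomial.induction_on' with
  | monomial u a =>
    let S : Polynomial ℚ := Polynomial.C (((u 0 : ℚ) + 1)⁻¹) * Polynomial.bernoulli (u 0 + 1)
    have hS : ∀ n : ℕ, S.eval ((n : ℚ) + 1) - S.eval (n : ℚ) = (n : ℚ) ^ u 0 := by
      intro n
      have := Polynomial.bernoulli_eval_one_add (u 0 + 1) (n : ℚ)
      rw [add_comm] at this
      simp only [S, Polynomial.eval_mul, Polynomial.eval_C, this]
      have h0 : ((u 0 : ℚ) + 1) ≠ 0 := by positivity
      push_cast
      field_simp
      ring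
    refine ⟨MvPolynomial.C a * Polynomial.aeval (MvPolynomial.X 0) S * MvPolynomial.X 1 ^ u 1,
      fun n m => ?_⟩
    have key : ∀ v : Fin 2 → ℚ, MvPolynomial.eval v
        (Polynomial.aeval (MvPolynomial.X 0 : MvPolynomial (Fin 2) ℚ) S) = S.eval (v 0) := by
      intro v
      rw [← MvPolynomial.coe_aeval_eq_eval, RingHom.coe_coe, ← Polynomial.aeval_algHom_apply,
        MvPolynomial.aeval_X, Polynomial.coe_aeval_eq_eval]
    simp only [map_mul, key, MvPolynomial.eval_C, map_pow, MvPolynomial.eval_X,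
      MvPolynomial.eval_monomial]
    rw [Finsupp.prod_fintype _ _ (by simp)]
    simp only [Fin.prod_univ_two]
    have := hS n
    simp only [Matrix.cons_val_zero, Matrix.cons_val_one]
    push_cast
    rw [← this]
    ring
  | add p q hp hq =>
    obtain ⟨p', hp⟩ := hp
    obtain ⟨q', hq⟩ := hq
    refine ⟨p' + q', fun n m => ?_⟩
    simp only [map_add, ← hp, ← hq]
    ring

theorem of_difference_left {g : ℕ → ℚ}
    (h : AgreesWithPolynomial fun n _ => g (n + 1) - g n) :
    AgreesWithPolynomial fun n _ => g n := by
  obtain ⟨p, k, hp⟩ := h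
  obtain ⟨q, hq⟩ := exists_antidifference p
  obtain ⟨l, hl⟩ := slice (f := fun n m => MvPolynomial.eval ![(n : ℚ), (m : ℚ)] q)
    ⟨q, 0, fun _ _ _ _ => rfl⟩
  have hg := (hl (max k l) (by lia)).add
    (const (g k - MvPolynomial.eval ![(k : ℚ), ((max k l : ℕ) : ℚ)] q))
  refine hg.of_eventually_eq k fun n _ hn _ => ?_
  induction n, hn using Nat.le_induction with
  | base => ring
  | succ n hn ih =>
    have h₁ := hp n (max k l) hn (by lia)
    have h₂ := hq n (max k l)
    linarith

theorem of_difference (h₁ : AgreesWithPolynomial fun n m => f (n + 1) m - f n m)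
    (h₂ : AgreesWithPolynomial fun n m => f n (m + 1) - f n m) : AgreesWithPolynomial f := by
  obtain ⟨p, k, hp⟩ := h₁
  obtain ⟨q, hq⟩ := exists_antidifference p
  have hq' : AgreesWithPolynomial fun n m => MvPolynomial.eval ![(n : ℚ), (m : ℚ)] q :=
    ⟨q, 0, fun _ _ _ _ => rfl⟩
  have hq'' : AgreesWithPolynomial fun n m : ℕ =>
      MvPolynomial.eval ![(n : ℚ), ((m + 1 : ℕ) : ℚ)] q := by
    refine ⟨MvPolynomial.bind₁ ![MvPolynomial.X 0, MvPolynomial.X 1 + 1] q, 0, fun n m _ _ => ?_⟩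
    beta_reduce
    rw [← MvPolynomial.coe_aeval_eq_eval, ← MvPolynomial.coe_aeval_eq_eval]
    simp only [RingHom.coe_coe, MvPolynomial.aeval_bind₁]
    congr 2
    ext i
    fin_cases i <;> simp
  obtain ⟨l, hl⟩ := (h₂.sub (hq''.sub hq')).swap.slice
  let r : ℕ → ℚ := fun m => f (max k l) m - MvPolynomial.eval ![((max k l : ℕ) : ℚ), (m : ℚ)] q
  have hr : AgreesWithPolynomial fun m _ => r m := by
    refine of_difference_left ((hl (max k l) (by lia)).of_eventually_eq 0 fun n m _ _ => ?_)
    simp only [r]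
    ring
  refine (hq'.add hr.swap).of_eventually_eq (max k l) fun n m hn hm => ?_
  induction n, hn using Nat.le_induction with
  | base => simp only [r]; ring
  | succ n hn ih =>
    have h₁ := hp n m (by lia) (by lia)
    have h₂ := hq n m
    linarith

end AgreesWithPolynomial

end EventuallyPolynomial

section HilbertPolynomial

variable {R : Type*} [CommRing R] {E : Type*} [AddCommGroup E] [Module R E]
  {s t : List (Module.End R E)} {B A : ℕ → ℕ → Submodule R E}

theorem IsHilbertPair.toNat_succ_sub {x : Module.End R E} (h : IsHilbertPair (x :: s) t B A)
    (n m : ℕ) : ((relLength (B (n + 1) m) (A (n + 1) m)).toNat : ℚ) -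
      (relLength (B n m) (A n m)).toNat =
      (relLength (B (n + 1) m ⊔ (A n m).map x) (A (n + 1) m)).toNat -
      (relLength (B n m) (A n m ⊓ (B (n + 1) m).comap x)).toNat := by
  have key := congrArg ENat.toNat (h.relLength_succ n m)
  rw [ENat.toNat_add (h.finite _ _) (h.kernel.finite _ _),
    ENat.toNat_add (h.finite _ _) (h.cokernel.finite _ _)] at key
  have key' := congrArg (Nat.cast (R := ℚ)) key
  push_cast at key'
  linarith

theorem IsHilbertPair.agreesWithPolynomial_left (h : IsHilbertPair s t B A) (m : ℕ) :
    AgreesWithPolynomial fun n _ => (relLength (B n m) (A n m)).toNat := by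
  induction s generalizing B A with
  | nil =>
    obtain ⟨k, hk⟩ := h.exists_relLength_eq_zero
    exact (AgreesWithPolynomial.const 0).of_eventually_eq k fun n _ hn _ => by
      simp [hk n m hn]
  | cons x s ih =>
    refine AgreesWithPolynomial.of_difference_left
      (g := fun n => ((relLength (B n m) (A n m)).toNat : ℚ)) ?_
    exact ((ih h.cokernel).sub (ih h.kernel)).of_eventually_eq 0
      fun n _ _ _ => h.toNat_succ_sub n m

theorem IsHilbertPair.agreesWithPolynomial_right (h : IsHilbertPair s t B A) (n : ℕ) :
    AgreesWithPolynomial fun _ m => (relLength (B n m) (A n m)).toNat :=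
  (h.swap.agreesWithPolynomial_left n).swap

theorem IsHilbertPair.agreesWithPolynomial (h : IsHilbertPair s t B A) :
    AgreesWithPolynomial fun n m => (relLength (B n m) (A n m)).toNat := by
  induction hl : s.length + t.length using Nat.strong_induction_on generalizing s t B A with
  | _ l ih =>
    match s, t, h with
    | [], _, h =>
      obtain ⟨k, hk⟩ := h.exists_relLength_eq_zero
      exact (AgreesWithPolynomial.const 0).of_eventually_eq k fun n m hn _ => by
        simp [hk n m hn]
    | _ :: _, [], h =>
      obtain ⟨k, hk⟩ := h.swap.exists_relLength_eq_zero
      exact (AgreesWithPolynomial.const 0).of_eventually_eq k fun n m _ hm => by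
        simp [hk m n hm]
    | x :: s, y :: t, h =>
      simp only [List.length_cons] at hl
      refine AgreesWithPolynomial.of_difference ?_ ?_
      · exact ((ih _ (by simp only [List.length_cons]; lia) h.cokernel rfl).sub
          (ih _ (by simp only [List.length_cons]; lia) h.kernel rfl)).of_eventually_eq 0
          fun n m _ _ => h.toNat_succ_sub n m
      · exact ((ih _ (by simp only [List.length_cons]; lia) h.swap.cokernel rfl).sub
          (ih _ (by simp only [List.length_cons]; lia) h.swap.kernel rfl)).swap.of_eventually_eq 0
          fun n m _ _ => h.swap.toNat_succ_sub m n

end HilbertPolynomial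

open IsLocalRing

section FilteredSystem

variable {R : Type*} [CommRing R]

theorem Submodule.map_le_map_smul {E E' : Type*} [AddCommGroup E] [Module R E] [AddCommGroup E']
    [Module R E'] {f : E →ₗ[R] E'} {U : Submodule R E} {V : Submodule R E'} (h : U.map f ≤ V)
    (I : Ideal R) : (I • U).map f ≤ I • V := by
  rw [Submodule.map_smul'']
  exact Submodule.smul_mono le_rfl h

/-- A complex with a chain map `φ`, a graded family `W` of finitely generated subcomplexes, and
degree one operators `y`, such that `φ` carries everything into degree zero and turns `y j` into
multiplication by `g j`. -/
structure FilteredSystem [IsLocalRing R] (I : Ideal R) {p q : ℕ} (a : Fin p → R) (g : Fin q → R)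
    (E : ℕ → Type*) [∀ k, AddCommGroup (E k)] [∀ k, Module R (E k)] where
  d : ∀ k, E (k + 1) →ₗ[R] E k
  φ : ∀ k, E k →ₗ[R] E k
  y : ∀ k, Fin q → Module.End R (E k)
  W : ℕ → ∀ k, Submodule R (E k)
  a_mem : ∀ i, a i ∈ I
  le_maximalIdeal : I ≤ maximalIdeal R
  g_mem : ∀ j, g j ∈ maximalIdeal R
  d_d : ∀ k z, d k (d (k + 1) z) = 0
  d_φ : ∀ k z, d k (φ (k + 1) z) = φ k (d k z)
  d_y : ∀ k j z, d k (y (k + 1) j z) = y k j (d k z)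
  φ_y : ∀ k j z, φ k (y k j z) = g j • φ k z
  y_y : ∀ k i j z, y k i (y k j z) = y k j (y k i z)
  map_d : ∀ m k, (W m (k + 1)).map (d k) ≤ W m k
  map_φ : ∀ m k, (W m k).map (φ k) ≤ W 0 k
  map_y : ∀ m k j, (W m k).map (y k j) ≤ W (m + 1) k
  fg : ∀ m k, (W m k).FG
  noetherian : ∀ k, IsNoetherianPair (List.ofFn fun i => algebraMap R (Module.End R (E k)) (a i))
    (List.ofFn (y k)) ⊥ (fun n m => I ^ n • W m k)
  annihilation : ∀ k, ∃ c, ∀ n m, maximalIdeal R ^ c • (I ^ n • W m (k + 1) ⊓ LinearMap.ker (d k)) ≤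
    (I ^ n • W m (k + 2)).map (d (k + 1))

namespace FilteredSystem

variable [IsLocalRing R] {I : Ideal R} {p q : ℕ} {a : Fin p → R} {g : Fin q → R}
  {E : ℕ → Type*} [∀ k, AddCommGroup (E k)] [∀ k, Module R (E k)]
  (S : FilteredSystem I a g E)

/-- The cycles of `I ^ n W ^ m` in degree `k + 1`. -/
def cycles (k n m : ℕ) : Submodule R (E (k + 1)) :=
  I ^ n • S.W m (k + 1) ⊓ LinearMap.ker (S.d k)

/-- The boundaries of `I ^ n W ^ m` in degree `k + 1`. -/
def boundaries (k n m : ℕ) : Submodule R (E (k + 1)) :=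
  (I ^ n • S.W m (k + 2)).map (S.d (k + 1))

theorem boundaries_le_cycles (k n m : ℕ) : S.boundaries k n m ≤ S.cycles k n m := by
  refine le_inf (Submodule.map_le_map_smul (S.map_d m (k + 1)) _) ?_
  rintro _ ⟨z, -, rfl⟩
  exact S.d_d k z

theorem smul_pow_stable (k : ℕ) : IsStableFamily
    (List.ofFn fun i => algebraMap R (Module.End R (E k)) (a i)) (List.ofFn (S.y k))
    (fun n m => I ^ n • S.W m k) := by
  constructor
  · intro x hx n m
    obtain ⟨i, rfl⟩ := List.mem_ofFn.1 hx
    rintro _ ⟨z, hz, rfl⟩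
    change a i • z ∈ I ^ (n + 1) • S.W m k
    rw [pow_succ', ← smul_eq_mul, Submodule.smul_assoc]
    exact Submodule.smul_mem_smul (S.a_mem i) hz
  · intro x hx n m
    obtain ⟨j, rfl⟩ := List.mem_ofFn.1 hx
    exact Submodule.map_le_map_smul (S.map_y m k j) _

theorem cycles_stable (k : ℕ) : IsStableFamily
    (List.ofFn fun i => algebraMap R (Module.End R (E (k + 1))) (a i)) (List.ofFn (S.y (k + 1)))
    (S.cycles k) := by
  constructor
  · intro x hx n m
    have := (S.smul_pow_stable (k + 1)).1 x hx n m
    obtain ⟨i, rfl⟩ := List.mem_ofFn.1 hx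
    rintro _ ⟨z, hz, rfl⟩
    exact ⟨this ⟨z, hz.1, rfl⟩, (LinearMap.ker (S.d k)).smul_mem (a i) hz.2⟩
  · intro x hx n m
    have := (S.smul_pow_stable (k + 1)).2 x hx n m
    obtain ⟨j, rfl⟩ := List.mem_ofFn.1 hx
    rintro _ ⟨z, hz, rfl⟩
    refine ⟨this ⟨z, hz.1, rfl⟩, ?_⟩
    have hz2 : S.d k z = 0 := hz.2
    change S.d k (S.y (k + 1) j z) = 0
    rw [S.d_y, hz2, map_zero]

theorem boundaries_stable (k : ℕ) : IsStableFamily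
    (List.ofFn fun i => algebraMap R (Module.End R (E (k + 1))) (a i)) (List.ofFn (S.y (k + 1)))
    (S.boundaries k) := by
  constructor
  · intro x hx n m
    obtain ⟨i, rfl⟩ := List.mem_ofFn.1 hx
    rintro _ ⟨_, ⟨z, hz, rfl⟩, rfl⟩
    exact ⟨a i • z, (S.smul_pow_stable (k + 2)).1 _ (List.mem_ofFn.2 ⟨i, rfl⟩) n m ⟨z, hz, rfl⟩,
      map_smul _ _ _⟩
  · intro x hx n m
    obtain ⟨j, rfl⟩ := List.mem_ofFn.1 hx
    rintro _ ⟨_, ⟨z, hz, rfl⟩, rfl⟩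
    exact ⟨S.y (k + 2) j z,
      (S.smul_pow_stable (k + 2)).2 _ (List.mem_ofFn.2 ⟨j, rfl⟩) n m ⟨z, hz, rfl⟩, S.d_y _ _ _⟩

theorem isFiniteLength_of_maximalIdeal_pow [IsNoetherianRing R] {V : Type*} [AddCommGroup V]
    [Module R V] [Module.Finite R V] {c : ℕ}
    (h : ∀ r ∈ maximalIdeal R ^ c, ∀ v : V, r • v = 0) : IsFiniteLength R V := by
  let Q := R ⧸ maximalIdeal R ^ c
  have : Module.IsTorsionBySet R V (maximalIdeal R ^ c : Ideal R) := fun v r => h r r.2 v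
  let _ : Module Q V := this.module
  have : IsScalarTower R Q V := Module.IsTorsionBySet.isScalarTower this
  have : Module.Finite Q V := Module.Finite.of_restrictScalars_finite R Q V
  have : IsArtinianRing Q := by
    rcases subsingleton_or_nontrivial Q with h | h
    · infer_instance
    have : IsLocalRing Q := .of_surjective' (Ideal.Quotient.mk _) Ideal.Quotient.mk_surjective
    rw [isArtinianRing_iff_isNilpotent_maximalIdeal]
    refine ⟨c, ?_⟩
    rw [← IsLocalRing.map_maximalIdeal_of_surjective (Ideal.Quotient.mk (maximalIdeal R ^ c))
      Ideal.Quotient.mk_surjective, ← Ideal.map_pow,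
      Ideal.map_quotient_self]
    rfl
  have : IsArtinian R V :=
    isArtinian_of_surjective_algebraMap (R := Q) Ideal.Quotient.mk_surjective
  exact isFiniteLength_iff_isNoetherian_isArtinian.2 ⟨inferInstance, inferInstance⟩

theorem isHilbertPair [IsNoetherianRing R] (k : ℕ) : IsHilbertPair
    (List.ofFn fun i => algebraMap R (Module.End R (E (k + 1))) (a i)) (List.ofFn (S.y (k + 1)))
    (S.boundaries k) (S.cycles k) where
  commute := by
    intro x hx y hy
    rcases List.mem_append.1 hx with hx | hx
    · obtain ⟨i, rfl⟩ := List.mem_ofFn.1 hx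
      exact Algebra.commute_algebraMap_left _ _
    · rcases List.mem_append.1 hy with hy | hy
      · obtain ⟨i, rfl⟩ := List.mem_ofFn.1 hy
        exact Algebra.commute_algebraMap_right _ _
      · obtain ⟨i, rfl⟩ := List.mem_ofFn.1 hx
        obtain ⟨j, rfl⟩ := List.mem_ofFn.1 hy
        exact LinearMap.ext fun z => S.y_y _ _ _ z
  stable_left := S.boundaries_stable k
  stable_right := S.cycles_stable k
  le := S.boundaries_le_cycles k
  finite n m := by
    obtain ⟨c, hc⟩ := S.annihilation k
    have : Module.Finite R (S.W m (k + 1)) := Module.Finite.iff_fg.2 (S.fg m (k + 1))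
    have : IsNoetherian R (S.W m (k + 1)) := inferInstance
    have : IsNoetherian R (S.cycles k n m) :=
      isNoetherian_of_le (inf_le_left.trans Submodule.smul_le_right)
    rw [relLength, Module.length_ne_top_iff]
    refine isFiniteLength_of_maximalIdeal_pow (c := c) fun r hr v => ?_
    obtain ⟨z, rfl⟩ := Submodule.Quotient.mk_surjective _ v
    exact (Submodule.Quotient.mk_eq_zero _).2 (hc n m (Submodule.smul_mem_smul hr z.2))
  noetherian := by
    intro C hC h₁ h₂
    obtain ⟨l, h₃, h₄⟩ := S.noetherian (k + 1) C hC bot_le (h₂.trans fun n m => inf_le_left)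
    exact ⟨l, fun n m hn => (h₃ n m hn).trans (sup_le_sup_right bot_le _),
      fun n m hm => (h₄ n m hm).trans (sup_le_sup_right bot_le _)⟩

theorem exists_cycles_le_boundaries (k : ℕ) : ∃ l c, ∀ n m, l ≤ n →
    S.cycles k (n + c) m ≤ S.boundaries k n m := by
  obtain ⟨c, hc⟩ := S.annihilation k
  obtain ⟨l, hl, -⟩ := S.noetherian (k + 1) (S.cycles k) (S.cycles_stable k) bot_le
    (fun n m => inf_le_left)
  refine ⟨l, c, fun n m hn => le_trans ?_ (hc n m)⟩
  suffices ∀ e, S.cycles k (n + e) m ≤ I ^ e • S.cycles k n m from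
    (this c).trans (Submodule.smul_mono_left (Ideal.pow_right_mono S.le_maximalIdeal c))
  intro e
  induction e with
  | zero => simp
  | succ e ih =>
    refine (hl (n + e) m (by lia)).trans (sup_le bot_le (iSup₂_le fun x hx => ?_))
    obtain ⟨i, rfl⟩ := List.mem_ofFn.1 hx
    rintro _ ⟨z, hz, rfl⟩
    rw [pow_succ', ← smul_eq_mul, Submodule.smul_assoc]
    exact Submodule.smul_mem_smul (S.a_mem i) (ih hz)

theorem exists_map_cycles_le_boundaries (k : ℕ) : ∃ l, ∀ n m, l ≤ m →
    (S.cycles k n m).map (S.φ (k + 1)) ≤ S.boundaries k n 0 := by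
  obtain ⟨c, hc⟩ := S.annihilation k
  obtain ⟨l, -, hl⟩ := S.noetherian (k + 1) (S.cycles k) (S.cycles_stable k) bot_le
    (fun n m => inf_le_left)
  suffices ∀ n e m, l ≤ m → (S.cycles k n (m + e)).map (S.φ (k + 1)) ≤
      maximalIdeal R ^ e • S.cycles k n 0 by
    refine ⟨l + c, fun n m hm => le_trans ?_ (hc n 0)⟩
    obtain ⟨m, rfl⟩ : ∃ m', m = m' + c := ⟨m - c, by lia⟩
    exact this n c m (by lia)
  intro n e m hm
  induction e with
  | zero =>
    rw [pow_zero, Ideal.one_eq_top, Submodule.top_smul]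
    rintro _ ⟨z, hz, rfl⟩
    refine ⟨Submodule.map_le_map_smul (S.map_φ m (k + 1)) _ ⟨z, hz.1, rfl⟩, ?_⟩
    have hz2 : S.d k z = 0 := hz.2
    change S.d k (S.φ (k + 1) z) = 0
    rw [S.d_φ, hz2, map_zero]
  | succ e ih =>
    refine (Submodule.map_mono ((hl n (m + e) (by lia)).trans
      (sup_le bot_le (iSup₂_le fun x hx => ?_)))).trans (Submodule.map_comap_le _ _)
    obtain ⟨j, rfl⟩ := List.mem_ofFn.1 hx
    rintro _ ⟨z, hz, rfl⟩
    change S.φ (k + 1) (S.y (k + 1) j z) ∈ maximalIdeal R ^ (e + 1) • S.cycles k n 0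
    rw [S.φ_y, pow_succ', ← smul_eq_mul, Submodule.smul_assoc]
    exact Submodule.smul_mem_smul (S.g_mem j) (ih ⟨z, hz, rfl⟩)

/-- The differential of the mapping cone of `φ`. -/
def coneD (k : ℕ) : E (k + 2) × E (k + 1) →ₗ[R] E (k + 1) × E k :=
  ((S.d (k + 1)).coprod (S.φ (k + 1))).prod (-(S.d k ∘ₗ LinearMap.snd R _ _))

@[simp]
theorem coneD_apply (k : ℕ) (z : E (k + 2) × E (k + 1)) :
    S.coneD k z = (S.d (k + 1) z.1 + S.φ (k + 1) z.2, -S.d k z.2) := rfl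

/-- The terms `I ^ n (W ^ 0 × W ^ m)` of the mapping cone. -/
def coneW (k n m : ℕ) : Submodule R (E (k + 1) × E k) :=
  (I ^ n • S.W 0 (k + 1)).prod (I ^ n • S.W m k)

theorem coneD_coneD (k : ℕ) (z : E (k + 3) × E (k + 2)) :
    S.coneD k (S.coneD (k + 1) z) = 0 := by
  simp [S.d_d, S.d_φ]

theorem coneD_mem {k n m : ℕ} {z : E (k + 2) × E (k + 1)} (hz : z ∈ S.coneW (k + 1) n m) :
    S.coneD k z ∈ S.coneW k n m := by
  refine ⟨add_mem (Submodule.map_le_map_smul (S.map_d 0 (k + 1)) _ ⟨_, hz.1, rfl⟩)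
    (Submodule.map_le_map_smul (S.map_φ m (k + 1)) _ ⟨_, hz.2, rfl⟩), ?_⟩
  exact neg_mem (Submodule.map_le_map_smul (S.map_d m k) _ ⟨_, hz.2, rfl⟩)

theorem exists_coneW_inf_ker_le (k : ℕ) : ∃ l, ∀ n m, l ≤ n →
    S.coneW (k + 1) n m ⊓ LinearMap.ker (S.coneD k) ≤
      (S.coneW (k + 2) 0 m).map (S.coneD (k + 1)) := by
  obtain ⟨l₁, c₁, h₁⟩ := S.exists_cycles_le_boundaries k
  obtain ⟨l₂, c₂, h₂⟩ := S.exists_cycles_le_boundaries (k + 1)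
  refine ⟨l₁ + l₂ + c₁ + c₂, ?_⟩
  rintro n m hn ⟨u, v⟩ ⟨⟨hu, hv⟩, huv⟩
  obtain ⟨n, rfl⟩ : ∃ n', n = n' + c₂ + c₁ := ⟨n - c₁ - c₂, by lia⟩
  have huv' : S.d (k + 1) u + S.φ (k + 1) v = 0 ∧ -S.d k v = 0 := by
    simpa using huv
  obtain ⟨w, hw, rfl⟩ := h₁ (n + c₂) m (by lia) ⟨hv, by simpa using huv'.2⟩
  obtain ⟨x, hx, hxu⟩ : u + S.φ (k + 2) w ∈ S.boundaries (k + 1) n 0 := by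
    refine h₂ n 0 (by lia) ⟨add_mem
      (Submodule.smul_mono_left (Ideal.pow_le_pow_right (by lia)) hu)
      (Submodule.map_le_map_smul (S.map_φ m (k + 2)) _ ⟨_, hw, rfl⟩), ?_⟩
    change S.d (k + 1) (u + S.φ (k + 2) w) = 0
    rw [map_add, S.d_φ, huv'.1]
  refine ⟨(x, -w), ⟨?_, ?_⟩, ?_⟩
  · exact Submodule.smul_mono_left (Ideal.pow_le_pow_right (Nat.zero_le _)) hx
  · exact neg_mem (Submodule.smul_mono_left (Ideal.pow_le_pow_right (Nat.zero_le _)) hw)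
  · simp [hxu]

/-- The cycles of `I ^ n (W ^ 0 × W ^ m)` in the mapping cone. -/
def coneCycles (k n m : ℕ) : Submodule R (E (k + 2) × E (k + 1)) :=
  S.coneW (k + 1) n m ⊓ LinearMap.ker (S.coneD k)

/-- The boundaries of `I ^ n (W ^ 0 × W ^ m)` in the mapping cone. -/
def coneBoundaries (k n m : ℕ) : Submodule R (E (k + 2) × E (k + 1)) :=
  (S.coneW (k + 2) n m).map (S.coneD (k + 1))

theorem coneBoundaries_le (k n m : ℕ) : S.coneBoundaries k n m ≤ S.coneCycles k n m := by
  rintro _ ⟨z, hz, rfl⟩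
  exact ⟨S.coneD_mem hz, S.coneD_coneD k z⟩

theorem coneW_mono (k m : ℕ) {n n' : ℕ} (h : n ≤ n') : S.coneW k n' m ≤ S.coneW k n m :=
  fun _ hz => ⟨Submodule.smul_mono_left (Ideal.pow_le_pow_right h) hz.1,
    Submodule.smul_mono_left (Ideal.pow_le_pow_right h) hz.2⟩

/-- The cycles of the mapping cone modulo `I ^ n`. -/
def quotientCycles (k n m : ℕ) : Submodule R (E (k + 2) × E (k + 1)) :=
  S.coneW (k + 1) 0 m ⊓ (S.coneW k n m).comap (S.coneD k)

/-- The boundaries of the mapping cone modulo `I ^ n`. -/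
def quotientBoundaries (k n m : ℕ) : Submodule R (E (k + 2) × E (k + 1)) :=
  S.coneBoundaries k 0 m ⊔ S.coneW (k + 1) n m

theorem relLength_quotient_eq {k n m : ℕ}
    (h₁ : S.coneCycles k n m ≤ S.coneBoundaries k 0 m)
    (h₂ : S.coneCycles (k + 1) n m ≤ S.coneBoundaries (k + 1) 0 m) :
    relLength (S.quotientBoundaries (k + 1) n m) (S.quotientCycles (k + 1) n m) =
      relLength (S.coneBoundaries (k + 1) 0 m) (S.coneCycles (k + 1) 0 m) +
      relLength (S.coneBoundaries k n m) (S.coneCycles k n m) := by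
  have hD : S.quotientBoundaries (k + 1) n m ≤ S.coneCycles (k + 1) 0 m ⊔ S.coneW (k + 2) n m :=
    sup_le_sup_right (S.coneBoundaries_le _ _ _) _
  have hW : S.coneCycles (k + 1) 0 m ⊔ S.coneW (k + 2) n m ≤ S.quotientCycles (k + 1) n m := by
    refine sup_le (fun z hz => ⟨hz.1, ?_⟩)
      fun z hz => ⟨S.coneW_mono _ _ (Nat.zero_le _) hz, S.coneD_mem hz⟩
    have hz2 : S.coneD (k + 1) z = 0 := hz.2
    change S.coneD (k + 1) z ∈ S.coneW (k + 1) n m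
    rw [hz2]
    exact zero_mem _
  rw [relLength_add hD hW]
  congr 1
  · refine (relLength_congr LinearMap.id (fun z hz => Submodule.mem_sup_left hz) ?_ ?_).symm
    · intro z hz
      obtain ⟨u, hu, v, hv, rfl⟩ := Submodule.mem_sup.1 hz
      refine ⟨u, hu, ?_⟩
      rw [LinearMap.id_apply, add_sub_cancel_left]
      exact Submodule.mem_sup_right hv
    · refine fun z hz => ⟨fun h => ?_, fun h => Submodule.mem_sup_left h⟩
      obtain ⟨u, hu, v, hv, rfl⟩ := Submodule.mem_sup.1 h
      refine add_mem hu (h₂ ⟨hv, ?_⟩)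
      have := sub_mem hz.2 (S.coneBoundaries_le _ _ _ hu).2
      simpa using this
  · refine relLength_congr (S.coneD (k + 1)) (fun z hz => ⟨hz.2, S.coneD_coneD k z⟩) ?_ ?_
    · intro z hz
      obtain ⟨w, hw, rfl⟩ := h₁ hz
      exact ⟨w, ⟨hw, hz.1⟩, by simp⟩
    · refine fun z hz => ⟨?_, fun h => ?_⟩
      · rintro ⟨w, hw, hwz⟩
        have hzw : S.coneD (k + 1) (z - w) = 0 := by rw [map_sub, hwz, sub_self]
        rw [← sub_add_cancel z w]
        exact Submodule.add_mem_sup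
          ⟨sub_mem hz.1 (S.coneW_mono _ _ (Nat.zero_le _) hw), hzw⟩ hw
      · obtain ⟨u, hu, v, hv, rfl⟩ := Submodule.mem_sup.1 h
        have hu2 : S.coneD (k + 1) u = 0 := hu.2
        exact ⟨v, hv, by rw [map_add, hu2, zero_add]⟩

theorem relLength_cone_eq {k n m : ℕ}
    (h₁ : (S.cycles k n m).map (S.φ (k + 1)) ≤ S.boundaries k n 0)
    (h₂ : (S.cycles (k + 1) n m).map (S.φ (k + 2)) ≤ S.boundaries (k + 1) n 0) :
    relLength (S.coneBoundaries k n m) (S.coneCycles k n m) =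
      relLength (S.boundaries (k + 1) n 0) (S.cycles (k + 1) n 0) +
      relLength (S.boundaries k n m) (S.cycles k n m) := by
  let i := LinearMap.inl R (E (k + 2)) (E (k + 1))
  have hi : (S.cycles (k + 1) n 0).map i ≤ S.coneCycles k n m := by
    rintro _ ⟨z, hz, rfl⟩
    have hz2 : S.d (k + 1) z = 0 := hz.2
    exact ⟨⟨hz.1, zero_mem _⟩, by simp [i, hz2]⟩
  rw [relLength_add (W := S.coneBoundaries k n m ⊔ (S.cycles (k + 1) n 0).map i) le_sup_left
    (sup_le (S.coneBoundaries_le _ _ _) hi)]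
  congr 1
  · refine (relLength_congr i (fun z hz => Submodule.mem_sup_right (Submodule.mem_map_of_mem hz))
      ?_ ?_).symm
    · intro z hz
      obtain ⟨u, hu, _, ⟨v, hv, rfl⟩, rfl⟩ := Submodule.mem_sup.1 hz
      exact ⟨v, hv, by simpa using hu⟩
    · refine fun z hz => ⟨?_, ?_⟩
      · rintro ⟨⟨u, v⟩, huv, h⟩
        simp only [i, coneD_apply, LinearMap.inl_apply, Prod.mk.injEq, neg_eq_zero] at h
        obtain ⟨w, hw, hwv⟩ := h₂ ⟨v, ⟨huv.2, h.2⟩, rfl⟩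
        exact ⟨u + w, add_mem huv.1 hw, by rw [map_add, hwv, h.1]⟩
      · rintro ⟨u, hu, rfl⟩
        exact ⟨(u, 0), ⟨hu, zero_mem _⟩, by simp [i]⟩
  · refine relLength_congr (LinearMap.snd R _ _) (fun z hz => ⟨hz.1.2, ?_⟩) ?_ ?_
    · have hz2 : S.coneD k z = 0 := hz.2
      simpa using congrArg Prod.snd hz2
    · intro z hz
      obtain ⟨w, hw, hwz⟩ := h₁ ⟨z, hz, rfl⟩
      have hz2 : S.d k z = 0 := hz.2
      exact ⟨(-w, z), ⟨⟨neg_mem hw, hz.1⟩, by simp [hwz, hz2]⟩, by simp⟩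
    · rintro ⟨u, v⟩ hz
      constructor
      · rintro ⟨w, hw, rfl⟩
        have hz2 : S.coneD k (u, S.d (k + 1) w) = 0 := hz.2
        have hz3 : S.d (k + 1) u + S.φ (k + 1) (S.d (k + 1) w) = 0 := by
          simpa using congrArg Prod.fst hz2
        refine Submodule.mem_sup.2 ⟨S.coneD (k + 1) (0, -w), ⟨_, ⟨zero_mem _, neg_mem hw⟩, rfl⟩,
          i (u + S.φ (k + 2) w), ⟨_, ⟨add_mem hz.1.1
            (Submodule.map_le_map_smul (S.map_φ m _) _ ⟨w, hw, rfl⟩), ?_⟩, rfl⟩, by simp [i]⟩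
        change S.d (k + 1) _ = 0
        rw [map_add, S.d_φ, hz3]
      · intro h
        obtain ⟨_, ⟨w, hw, rfl⟩, _, ⟨x, hx, rfl⟩, h⟩ := Submodule.mem_sup.1 h
        refine ⟨-w.2, neg_mem hw.2, ?_⟩
        have := congrArg Prod.snd h
        simpa [i] using this

/-- The homology of the mapping cone modulo `I ^ n` eventually has polynomial length. -/
theorem agreesWithPolynomial [IsNoetherianRing R] (k : ℕ) :
    ∃ F : ℕ → ℕ → ℕ, AgreesWithPolynomial (fun n m => F n m) ∧ ∃ l, ∀ n m, l ≤ n → l ≤ m →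
      relLength (S.quotientBoundaries (k + 1) n m) (S.quotientCycles (k + 1) n m) = F n m := by
  let h (k n m : ℕ) : ℕ := (relLength (S.boundaries k n m) (S.cycles k n m)).toNat
  have hh (k n m : ℕ) : relLength (S.boundaries k n m) (S.cycles k n m) = h k n m :=
    (ENat.natCast_toNat ((S.isHilbertPair k).finite n m)).symm
  refine ⟨fun n m => (h (k + 2) 0 0 + h (k + 1) 0 m) + (h (k + 1) n 0 + h k n m), ?_, ?_⟩
  · push_cast
    exact ((AgreesWithPolynomial.const _).add
      ((S.isHilbertPair (k + 1)).agreesWithPolynomial_right 0)).add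
      (((S.isHilbertPair (k + 1)).agreesWithPolynomial_left 0).add
        (S.isHilbertPair k).agreesWithPolynomial)
  obtain ⟨l₁, h₁⟩ := S.exists_coneW_inf_ker_le k
  obtain ⟨l₂, h₂⟩ := S.exists_coneW_inf_ker_le (k + 1)
  obtain ⟨l₃, h₃⟩ := S.exists_map_cycles_le_boundaries k
  obtain ⟨l₄, h₄⟩ := S.exists_map_cycles_le_boundaries (k + 1)
  obtain ⟨l₅, h₅⟩ := S.exists_map_cycles_le_boundaries (k + 2)
  refine ⟨l₁ + l₂ + l₃ + l₄ + l₅, fun n m hn hm => ?_⟩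
  rw [S.relLength_quotient_eq (h₁ n m (by lia)) (h₂ n m (by lia)),
    S.relLength_cone_eq (h₄ 0 m (by lia)) (h₅ 0 m (by lia)),
    S.relLength_cone_eq (h₃ n m (by lia)) (h₄ n m (by lia))]
  simp only [hh]
  push_cast
  rfl

end FilteredSystem

end FilteredSystem

section NoetherianPair

variable {R : Type*} [CommRing R] {E : Type*} [AddCommGroup E] [Module R E]
  {s t : List (Module.End R E)} {A : ℕ → ℕ → Submodule R E}

theorem IsStableFamily.exists_le_iSup_map
    (hcomm : ∀ x ∈ s, ∀ y ∈ t, Commute x y)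
    (hacc : ∀ V : ℕ → ℕ → ℕ → Submodule R E, Monotone V → (∀ k, IsStableFamily s t (V k)) →
      (∀ k, V k ≤ A) → ∃ l, ∀ k, l ≤ k → V l = V k)
    {C : ℕ → ℕ → Submodule R E} (hC : IsStableFamily s t C) (hCA : C ≤ A) :
    ∃ l, ∀ n m, l ≤ n → C (n + 1) m ≤ ⨆ x ∈ s, (C n m).map x := by
  let S (n m : ℕ) : Submodule R E := ⨆ x ∈ s, (C n m).map x
  have hS (n m) : S n m ≤ C (n + 1) m := iSup₂_le fun x hx => hC.1 x hx n m
  have hx (n m) (x) (hx : x ∈ s) : (C n m).map x ≤ S n m :=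
    le_iSup₂_of_le (f := fun x (_ : x ∈ s) => (C n m).map x) x hx le_rfl
  let V (k n m : ℕ) : Submodule R E := Nat.casesOn n (C 0 m) fun n =>
    if n < k then C (n + 1) m else S n m
  have hVC (k) : V k ≤ C := by
    rintro (_ | n) m
    · exact le_rfl
    · change (if n < k then C (n + 1) m else S n m) ≤ C (n + 1) m
      split_ifs
      exacts [le_rfl, hS n m]
  have hSV (k n m) : S n m ≤ V k (n + 1) m := by
    change S n m ≤ (if n < k then C (n + 1) m else S n m)
    split_ifs
    exacts [hS n m, le_rfl]
  have hVm : Monotone V := by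
    intro k k' hk n m
    cases n with
    | zero => exact le_rfl
    | succ n =>
      change (if n < k then C (n + 1) m else S n m) ≤ (if n < k' then C (n + 1) m else S n m)
      by_cases h : n < k
      · rw [if_pos h, if_pos (h.trans_le hk)]
      · rw [if_neg h]
        split_ifs
        exacts [hS n m, le_rfl]
  have hVs (k) : IsStableFamily s t (V k) := by
    constructor
    · intro x hxs n m
      exact ((Submodule.map_mono (hVC k n m)).trans (hx n m x hxs)).trans (hSV k n m)
    · rintro y hy (_ | n) m
      · exact hC.2 y hy 0 m
      · change (if n < k then C (n + 1) m else S n m).map y ≤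
          (if n < k then C (n + 1) (m + 1) else S n (m + 1))
        split_ifs
        · exact hC.2 y hy (n + 1) m
        · simp only [S, Submodule.map_iSup]
          refine iSup₂_le fun x hxs => le_trans ?_ (hx n (m + 1) x hxs)
          rintro _ ⟨_, ⟨v, hv, rfl⟩, rfl⟩
          exact ⟨y v, hC.2 y hy n m ⟨v, hv, rfl⟩, LinearMap.congr_fun (hcomm x hxs y hy).eq v⟩
  obtain ⟨l, hl⟩ := hacc V hVm hVs fun k => (hVC k).trans hCA
  refine ⟨l, fun n m hn => ?_⟩
  have h₁ : V l (n + 1) m = S n m := if_neg (by lia)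
  have h₂ : V (n + 1) (n + 1) m = C (n + 1) m := if_pos (by lia)
  rw [← h₂, ← hl (n + 1) (by lia), h₁]

theorem isNoetherianPair_of_stabilizes
    (hcomm : ∀ x ∈ s, ∀ y ∈ t, Commute x y)
    (hacc : ∀ V : ℕ → ℕ → ℕ → Submodule R E, Monotone V → (∀ k, IsStableFamily s t (V k)) →
      (∀ k, V k ≤ A) → ∃ l, ∀ k, l ≤ k → V l = V k) :
    IsNoetherianPair s t ⊥ A := by
  intro C hC _ hCA
  obtain ⟨l₁, h₁⟩ := hC.exists_le_iSup_map hcomm hacc hCA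
  obtain ⟨l₂, h₂⟩ := hC.swap.exists_le_iSup_map (A := fun n m => A m n)
    (fun y hy x hx => (hcomm x hx y hy).symm) (by
      intro V hV hst hVA
      obtain ⟨l, hl⟩ := hacc (fun k n m => V k m n) (fun k k' hk n m => hV hk m n)
        (fun k => (hst k).swap) (fun k n m => hVA k m n)
      exact ⟨l, fun k hk => funext₂ fun n m => congrFun₂ (hl k hk) m n⟩)
    fun n m => hCA m n
  exact ⟨max l₁ l₂, fun n m hn => (h₁ n m (by lia)).trans le_sup_right,
    fun n m hm => (h₂ m n (by lia)).trans le_sup_right⟩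

/-- A bigraded parametrization by a Noetherian module over a polynomial ring in two sets of
variables shows that a pair is Noetherian. -/
theorem isNoetherianPair_of_parametrization {p q : ℕ} {x : Fin p → Module.End R E}
    {y : Fin q → Module.End R E} (hcomm : ∀ i j, Commute (x i) (y j))
    {L : Type*} [AddCommGroup L] [Module (MvPolynomial (Fin p) (MvPolynomial (Fin q) R)) L]
    [Module R L] [IsScalarTower R (MvPolynomial (Fin p) (MvPolynomial (Fin q) R)) L]
    [IsNoetherian (MvPolynomial (Fin p) (MvPolynomial (Fin q) R)) L]
    (θ : ℕ → ℕ → L →ₗ[R] E)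
    (hx₀ : ∀ i m u, θ 0 m ((MvPolynomial.X i : MvPolynomial (Fin p) (MvPolynomial (Fin q) R)) • u)
      = 0)
    (hx : ∀ i n m u, θ (n + 1) m
      ((MvPolynomial.X i : MvPolynomial (Fin p) (MvPolynomial (Fin q) R)) • u) = x i (θ n m u))
    (hy₀ : ∀ j n u, θ n 0 ((MvPolynomial.C (MvPolynomial.X j) :
      MvPolynomial (Fin p) (MvPolynomial (Fin q) R)) • u) = 0)
    (hy : ∀ j n m u, θ n (m + 1) ((MvPolynomial.C (MvPolynomial.X j) :
      MvPolynomial (Fin p) (MvPolynomial (Fin q) R)) • u) = y j (θ n m u))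
    (hA : ∀ n m, ∀ z ∈ A n m, ∃ u, θ n m u = z ∧
      ∀ n' m', (n', m') ≠ (n, m) → θ n' m' u = 0) :
    IsNoetherianPair (List.ofFn x) (List.ofFn y) ⊥ A := by
  refine isNoetherianPair_of_stabilizes ?_ ?_
  · intro x' hx' y' hy'
    obtain ⟨i, rfl⟩ := List.mem_ofFn.1 hx'
    obtain ⟨j, rfl⟩ := List.mem_ofFn.1 hy'
    exact hcomm i j
  intro V hV hst hVA
  let G (k : ℕ) : Submodule (MvPolynomial (Fin p) (MvPolynomial (Fin q) R)) L :=
    { carrier := {u | ∀ n m, θ n m u ∈ V k n m}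
      add_mem' := fun hu hv n m => by rw [map_add]; exact add_mem (hu n m) (hv n m)
      zero_mem' := fun n m => by rw [map_zero]; exact zero_mem _
      smul_mem' := by
        have hX : ∀ i u, (∀ n m, θ n m u ∈ V k n m) → ∀ n m, θ n m
            ((MvPolynomial.X i : MvPolynomial (Fin p) (MvPolynomial (Fin q) R)) • u) ∈
              V k n m := by
          rintro i u hu (_ | n) m
          · rw [hx₀]; exact zero_mem _
          · rw [hx]
            exact (hst k).1 _ (List.mem_ofFn.2 ⟨i, rfl⟩) n m ⟨_, hu n m, rfl⟩
        have hY : ∀ j u, (∀ n m, θ n m u ∈ V k n m) → ∀ n m, θ n m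
            ((MvPolynomial.C (MvPolynomial.X j) :
              MvPolynomial (Fin p) (MvPolynomial (Fin q) R)) • u) ∈ V k n m := by
          rintro j u hu n (_ | m)
          · rw [hy₀]; exact zero_mem _
          · rw [hy]
            exact (hst k).2 _ (List.mem_ofFn.2 ⟨j, rfl⟩) n m ⟨_, hu n m, rfl⟩
        have hC : ∀ (c : MvPolynomial (Fin q) R) u, (∀ n m, θ n m u ∈ V k n m) → ∀ n m, θ n m
            ((MvPolynomial.C c : MvPolynomial (Fin p) (MvPolynomial (Fin q) R)) • u) ∈
              V k n m := by
          intro c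
          induction c using MvPolynomial.induction_on with
          | C r =>
            intro u hu n m
            have : (MvPolynomial.C (MvPolynomial.C r) :
                MvPolynomial (Fin p) (MvPolynomial (Fin q) R)) • u = r • u := by
              rw [← algebraMap_smul (MvPolynomial (Fin p) (MvPolynomial (Fin q) R)) r u]
              rfl
            rw [this, map_smul]
            exact Submodule.smul_mem _ _ (hu n m)
          | add c c' h h' =>
            intro u hu n m
            rw [map_add, add_smul, map_add]
            exact add_mem (h u hu n m) (h' u hu n m)
          | mul_X c j h =>
            intro u hu n m
            rw [map_mul, mul_smul]
            exact h _ (hY j u hu) n m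
        intro c u hu
        change ∀ n m, θ n m (c • u) ∈ V k n m
        replace hu : ∀ n m, θ n m u ∈ V k n m := hu
        induction c using MvPolynomial.induction_on generalizing u with
        | C c => exact hC c u hu
        | add c c' h h' =>
          intro n m
          rw [add_smul, map_add]
          exact add_mem (h hu n m) (h' hu n m)
        | mul_X c i h =>
          rw [mul_smul]
          exact h (hX i u hu) }
  obtain ⟨l, hl⟩ := monotone_stabilizes_iff_noetherian.2
    (inferInstanceAs (IsNoetherian (MvPolynomial (Fin p) (MvPolynomial (Fin q) R)) L))
    ⟨G, fun k k' hk u hu n m => hV hk n m (hu n m)⟩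
  refine ⟨l, fun k hk => le_antisymm (hV hk) fun n m z hz => ?_⟩
  obtain ⟨u, rfl, hu⟩ := hA n m z (hVA k n m hz)
  have huk : u ∈ G k := by
    intro n' m'
    by_cases h : (n', m') = (n, m)
    · obtain ⟨rfl, rfl⟩ := Prod.mk.inj h
      exact hz
    · rw [hu n' m' h]
      exact zero_mem _
  have hul : u ∈ G l := by
    have : G l = G k := hl k hk
    rwa [this]
  exact hul n m

end NoetherianPair

section GradedFree

variable {R : Type*} [CommRing R] {q : ℕ}

open MvPolynomial

theorem MvPolynomial.homogeneousComponent_succ_X_mul {σ : Type*} (i : σ) (n : ℕ)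
    (p : MvPolynomial σ R) :
    homogeneousComponent (n + 1) (X i * p) = X i * homogeneousComponent n p := by
  classical
  ext d
  rw [coeff_homogeneousComponent, coeff_X_mul', coeff_X_mul', coeff_homogeneousComponent]
  by_cases h : i ∈ d.support
  · have hd : (d - Finsupp.single i 1).degree + 1 = d.degree := by
      have : Finsupp.single i 1 ≤ d := by
        rw [Finsupp.single_le_iff]
        exact Nat.one_le_iff_ne_zero.2 (Finsupp.mem_support_iff.1 h)
      conv_rhs => rw [← tsub_add_cancel_of_le this]
      rw [map_add, Finsupp.degree_single]
    simp only [h, if_true, ← hd, add_left_inj]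
  · simp [h]

theorem MvPolynomial.homogeneousComponent_zero_X_mul {σ : Type*} (i : σ) (p : MvPolynomial σ R) :
    homogeneousComponent 0 (X i * p) = 0 := by
  classical
  rw [homogeneousComponent_zero, coeff_X_mul', if_neg (by simp), C_0]

theorem MvPolynomial.homogeneousComponent_homogeneousComponent {σ : Type*} (m n : ℕ)
    (p : MvPolynomial σ R) : homogeneousComponent m (homogeneousComponent n p) =
      if m = n then homogeneousComponent m p else 0 := by
  rw [homogeneousComponent_of_mem (homogeneousComponent_mem n p)]
  split_ifs with h
  · rw [h]
  · rfl

theorem MvPolynomial.homogeneousComponent_C {σ : Type*} (m : ℕ) (a : R) :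
    homogeneousComponent m (C a : MvPolynomial σ R) = if m = 0 then C a else 0 :=
  homogeneousComponent_of_mem (isHomogeneous_C σ a)

/-- The degree `m` component on a free module over a polynomial ring, whose basis vectors have
degrees `δ`. -/
noncomputable def gradedComponent {r : ℕ} (δ : Fin r → ℕ) (m : ℕ) :
    (Fin r → MvPolynomial (Fin q) R) →ₗ[R] (Fin r → MvPolynomial (Fin q) R) :=
  LinearMap.pi fun k => if δ k ≤ m then homogeneousComponent (m - δ k) ∘ₗ LinearMap.proj k else 0

variable {r : ℕ} (δ : Fin r → ℕ) (v : Fin r → MvPolynomial (Fin q) R)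

theorem gradedComponent_apply (m : ℕ) (k : Fin r) : gradedComponent δ m v k =
    if δ k ≤ m then homogeneousComponent (m - δ k) (v k) else 0 := by
  simp only [gradedComponent, LinearMap.pi_apply]
  split_ifs <;> rfl

theorem gradedComponent_succ_X_smul (j : Fin q) (m : ℕ) :
    gradedComponent δ (m + 1) ((X j : MvPolynomial (Fin q) R) • v) =
      (X j : MvPolynomial (Fin q) R) • gradedComponent δ m v := by
  ext1 k
  simp only [gradedComponent_apply, Pi.smul_apply, smul_eq_mul]
  by_cases h : δ k ≤ m
  · rw [if_pos h, if_pos (by lia), Nat.sub_add_comm h, homogeneousComponent_succ_X_mul]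
  · rw [if_neg h, mul_zero]
    split_ifs with h'
    · rw [show m + 1 - δ k = 0 by lia, homogeneousComponent_zero_X_mul]
    · rfl

theorem gradedComponent_zero_X_smul (j : Fin q) :
    gradedComponent δ 0 ((X j : MvPolynomial (Fin q) R) • v) = 0 := by
  ext1 k
  simp only [gradedComponent_apply, Pi.smul_apply, smul_eq_mul, Nat.zero_sub,
    homogeneousComponent_zero_X_mul, ite_self, Pi.zero_apply]

theorem gradedComponent_gradedComponent (m n : ℕ) : gradedComponent δ m (gradedComponent δ n v) =
    if m = n then gradedComponent δ m v else 0 := by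
  ext1 k
  simp only [gradedComponent_apply]
  split_ifs with h₁ h₂ h₃ h₄ h₅
  · subst h₃
    rw [homogeneousComponent_homogeneousComponent, if_pos rfl, gradedComponent_apply, if_pos h₁]
  · rw [homogeneousComponent_homogeneousComponent, if_neg (by lia)]
    rfl
  · lia
  · simp
  · rw [gradedComponent_apply, if_neg h₁]
  · rfl

theorem gradedComponent_of_eq {n : ℕ} (h : gradedComponent δ n v = v) (m : ℕ) :
    gradedComponent δ m v = if m = n then v else 0 := by
  conv_lhs => rw [← h, gradedComponent_gradedComponent]
  split_ifs with h'
  · rw [h', h]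
  · rfl

theorem exists_sum_gradedComponent : ∃ K, v = ∑ m ∈ Finset.range K, gradedComponent δ m v := by
  obtain ⟨K, hK⟩ : ∃ K, ∀ k, δ k + (v k).totalDegree < K := by
    refine ⟨∑ k, (δ k + (v k).totalDegree) + 1, fun k => Nat.lt_succ_of_le ?_⟩
    exact Finset.single_le_sum (f := fun k => δ k + (v k).totalDegree)
      (fun _ _ => Nat.zero_le _) (Finset.mem_univ k)
  refine ⟨K, ?_⟩
  ext1 k
  rw [Finset.sum_apply]
  simp only [gradedComponent_apply]
  obtain ⟨L, hL⟩ : ∃ L, K = δ k + L := ⟨K - δ k, by have := hK k; lia⟩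
  rw [hL, Finset.sum_range_add, Finset.sum_eq_zero (s := Finset.range (δ k)), zero_add]
  · simp only [Nat.le_add_right, if_true, Nat.add_sub_cancel_left]
    have hd : (v k).totalDegree + 1 ≤ L := by have := hK k; lia
    conv_lhs => rw [← sum_homogeneousComponent (v k)]
    refine Finset.sum_subset (Finset.range_mono hd) fun m _ hm => ?_
    exact homogeneousComponent_eq_zero _ _ (by simpa using hm)
  · intro m hm
    rw [if_neg (by simpa using hm)]

theorem gradedComponent_smul {n : ℕ} (h : gradedComponent δ n v = v) (p : MvPolynomial (Fin q) R)
    (m : ℕ) : gradedComponent δ m (p • v) =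
      (if n ≤ m then homogeneousComponent (m - n) p else 0) • v := by
  induction p using MvPolynomial.induction_on generalizing m with
  | C a =>
    have : ∀ w : Fin r → MvPolynomial (Fin q) R, (C a : MvPolynomial (Fin q) R) • w = a • w :=
      fun w => by rw [← algebraMap_smul (MvPolynomial (Fin q) R) a w]; rfl
    rw [this, map_smul, gradedComponent_of_eq δ v h]
    split_ifs with h₁ h₂ h₂
    · rw [h₁, Nat.sub_self, homogeneousComponent_C, if_pos rfl, this]
    · lia
    · rw [homogeneousComponent_C, if_neg (by lia), zero_smul, smul_zero]
    · rw [zero_smul, smul_zero]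
  | add p p' hp hp' =>
    rw [add_smul, map_add, hp, hp', ← add_smul]
    split_ifs <;> simp
  | mul_X p j hp =>
    rw [mul_comm, mul_smul]
    cases m with
    | zero =>
      rw [gradedComponent_zero_X_smul]
      split_ifs
      · rw [Nat.zero_sub, homogeneousComponent_zero_X_mul, zero_smul]
      · rw [zero_smul]
    | succ m =>
      rw [gradedComponent_succ_X_smul, hp]
      by_cases h₁ : n ≤ m
      · rw [if_pos h₁, if_pos (by lia), Nat.sub_add_comm h₁, homogeneousComponent_succ_X_mul,
          mul_smul]
      · rw [if_neg h₁, zero_smul, smul_zero]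
        split_ifs
        · rw [show m + 1 - n = 0 by lia, homogeneousComponent_zero_X_mul, zero_smul]
        · rw [zero_smul]

theorem gradedComponent_linearCombination {r' : ℕ} {δ' : Fin r' → ℕ}
    {h : Fin r' → Fin r → MvPolynomial (Fin q) R} (hh : ∀ l, gradedComponent δ (δ' l) (h l) = h l)
    (m : ℕ) (w : Fin r' → MvPolynomial (Fin q) R) :
    gradedComponent δ m (Fintype.linearCombination (MvPolynomial (Fin q) R) h w) =
      Fintype.linearCombination (MvPolynomial (Fin q) R) h (gradedComponent δ' m w) := by
  simp only [Fintype.linearCombination_apply, map_sum]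
  refine Finset.sum_congr rfl fun l _ => ?_
  rw [gradedComponent_smul δ (h l) (hh l), gradedComponent_apply]

theorem fg_range_gradedComponent [IsNoetherianRing R] (m : ℕ) :
    (LinearMap.range (gradedComponent (R := R) (q := q) δ m)).FG := by
  let f : (Fin r → restrictTotalDegree (Fin q) R m) →ₗ[R] (Fin r → MvPolynomial (Fin q) R) :=
    LinearMap.pi fun k => Submodule.subtype _ ∘ₗ LinearMap.proj k
  have hf : LinearMap.range (gradedComponent (R := R) (q := q) δ m) ≤ LinearMap.range f := by
    rintro _ ⟨v, rfl⟩
    refine ⟨fun k => ⟨gradedComponent δ m v k, ?_⟩, rfl⟩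
    rw [mem_restrictTotalDegree, gradedComponent_apply]
    split_ifs
    · exact ((homogeneousComponent_isHomogeneous _ _).totalDegree_le).trans (Nat.sub_le _ _)
    · simp
  have : IsNoetherian R (LinearMap.range f) := inferInstance
  have := isNoetherian_of_le hf
  exact Module.Finite.iff_fg.1 inferInstance

/-- Homogeneous submodules of graded free modules of finite rank are images of graded maps. -/
theorem exists_graded_cover [IsNoetherianRing R]
    (K : Submodule (MvPolynomial (Fin q) R) (Fin r → MvPolynomial (Fin q) R))
    (hK : ∀ v ∈ K, ∀ m, gradedComponent δ m v ∈ K) :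
    ∃ (r' : ℕ) (δ' : Fin r' → ℕ) (d : (Fin r' → MvPolynomial (Fin q) R)
      →ₗ[MvPolynomial (Fin q) R] (Fin r → MvPolynomial (Fin q) R)),
      LinearMap.range d = K ∧ ∀ m w, gradedComponent δ m (d w) = d (gradedComponent δ' m w) := by
  let s : Set (Fin r → MvPolynomial (Fin q) R) := {v | v ∈ K ∧ ∃ n, gradedComponent δ n v = v}
  have hs : Submodule.span (MvPolynomial (Fin q) R) s = K := by
    refine le_antisymm (Submodule.span_le.2 fun v hv => hv.1) fun v hv => ?_
    obtain ⟨L, hL⟩ := exists_sum_gradedComponent δ v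
    rw [hL]
    refine Submodule.sum_mem _ fun m _ => Submodule.subset_span ⟨hK v hv m, m, ?_⟩
    rw [gradedComponent_gradedComponent, if_pos rfl]
  obtain ⟨t, hts, ht⟩ := (Submodule.fg_span_iff_fg_span_finset_subset s).1
    (hs ▸ IsNoetherian.noetherian K)
  let e := t.equivFin.symm
  choose δ' hδ' using fun l : Fin t.card => (hts (e l).2).2
  refine ⟨t.card, δ', Fintype.linearCombination _ fun l => ((e l : t) : _), ?_,
    gradedComponent_linearCombination δ hδ'⟩
  rw [Fintype.range_linearCombination, ← hs, ht]
  congr 1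
  ext v
  constructor
  · rintro ⟨l, rfl⟩
    exact (e l).2
  · intro hv
    exact ⟨e.symm ⟨v, hv⟩, by simp⟩

end GradedFree

section GradedResolution

open MvPolynomial

theorem exists_dependent_seq {α : ℕ → Type*} {G : ∀ k, α k → Prop}
    {Q : ∀ k, α k → α (k + 1) → Prop} (h₀ : ∃ a, G 0 a)
    (h : ∀ k a, G k a → ∃ b, G (k + 1) b ∧ Q k a b) :
    ∃ f : ∀ k, α k, ∀ k, G k (f k) ∧ Q k (f k) (f (k + 1)) := by
  choose next hG hQ using h
  let F : ∀ k, {a : α k // G k a} := fun k => Nat.rec ⟨h₀.choose, h₀.choose_spec⟩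
    (fun k a => ⟨next k a.1 a.2, hG k a.1 a.2⟩) k
  exact ⟨fun k => (F k).1, fun k => ⟨(F k).2, hQ k (F k).1 (F k).2⟩⟩

/-- A graded free resolution, over the polynomial ring in variables `X j`, of the Rees module of
`N` with respect to the ideal generated by the `g j`, placed in degrees at least `3` with zeros
below. The augmentation `aug` is the sum of the augmentations of the graded pieces, which take
values in powers of the ideal times `N`. -/
structure GradedResolution {R : Type*} [CommRing R] {q : ℕ} (g : Fin q → R) (N : Type*)
    [AddCommGroup N] [Module R N] where
  r : ℕ → ℕ
  δ : ∀ k, Fin (r k) → ℕ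
  d : ∀ k, (Fin (r (k + 1)) → MvPolynomial (Fin q) R) →ₗ[MvPolynomial (Fin q) R]
    (Fin (r k) → MvPolynomial (Fin q) R)
  aug : ∀ k, (Fin (r k) → MvPolynomial (Fin q) R) →ₗ[R] N
  gradedComponent_d : ∀ k m v,
    gradedComponent (δ k) m (d k v) = d k (gradedComponent (δ (k + 1)) m v)
  mem_range_iff : ∀ k z, z ∈ LinearMap.range (d (k + 1)) ↔
    d k z = 0 ∧ ∀ m, aug (k + 1) (gradedComponent (δ (k + 1)) m z) = 0
  aug_X : ∀ k j v, aug k ((X j : MvPolynomial (Fin q) R) • v) = g j • aug k v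
  subsingleton : ∀ k < 3, Subsingleton (Fin (r k) → MvPolynomial (Fin q) R)
  aug_eq_zero : ∀ k ≠ 3, aug k = 0
  exists_degree_zero : ∀ k z, ∃ u, gradedComponent (δ k) 0 u = u ∧ aug k u = aug k z
  aug_surjective : Function.Surjective (aug 3)
  δ_three : ∀ l, δ 3 l = 0

theorem GradedResolution.exists_of_finite {R : Type*} [CommRing R] [IsNoetherianRing R] {q : ℕ}
    (g : Fin q → R) (N : Type*) [AddCommGroup N] [Module R N] [Module.Finite R N] :
    Nonempty (GradedResolution g N) := by
  obtain ⟨n, π, hπ⟩ := Module.Finite.exists_fin' R N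
  let ε : (Fin n → MvPolynomial (Fin q) R) →ₗ[R] N :=
    π ∘ₗ LinearMap.pi fun k => (aeval g).toLinearMap ∘ₗ LinearMap.proj k
  have hε (w : Fin n → R) : gradedComponent (R := R) (q := q) (fun _ : Fin n => 0) 0
      (fun k => C (w k)) = (fun k => C (w k)) ∧ ε (fun k => C (w k)) = π w := by
    constructor
    · ext1 k
      rw [gradedComponent_apply, if_pos le_rfl, homogeneousComponent_C, if_pos rfl]
    · change π _ = π w
      congr 1
      ext k
      simp
  have hεX (j v) : ε ((X j : MvPolynomial (Fin q) R) • v) = g j • ε v := by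
    change π _ = g j • π _
    rw [← map_smul]
    congr 1
    ext k
    simp
  let K₀ : Submodule (MvPolynomial (Fin q) R) (Fin n → MvPolynomial (Fin q) R) :=
    { carrier := {v | ∀ m, ε (gradedComponent (fun _ => 0) m v) = 0}
      add_mem' := fun hu hv m => by rw [map_add, map_add, hu m, hv m, add_zero]
      zero_mem' := fun m => by rw [map_zero, map_zero]
      smul_mem' := by
        intro c v hv
        change ∀ m, ε (gradedComponent (fun _ => 0) m (c • v)) = 0
        replace hv : ∀ m, ε (gradedComponent (fun _ => 0) m v) = 0 := hv
        induction c using MvPolynomial.induction_on generalizing v with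
        | C a =>
          intro m
          have : (C a : MvPolynomial (Fin q) R) • v = a • v := by
            rw [← algebraMap_smul (MvPolynomial (Fin q) R) a v]; rfl
          rw [this, map_smul, map_smul, hv, smul_zero]
        | add p p' h h' =>
          intro m
          rw [add_smul, map_add, map_add, h hv, h' hv, add_zero]
        | mul_X p j h =>
          rw [mul_smul]
          refine h ?_
          rintro (_ | m)
          · rw [gradedComponent_zero_X_smul, map_zero]
          · rw [gradedComponent_succ_X_smul, hεX, hv, smul_zero] }
  have hK₀ : ∀ v ∈ K₀, ∀ m, gradedComponent (fun _ => 0) m v ∈ K₀ := by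
    intro v hv m m'
    rw [gradedComponent_gradedComponent]
    split_ifs
    · exact hv m'
    · exact map_zero _
  let α : Type _ := Σ r : ℕ, (Fin r → ℕ) ×
    Submodule (MvPolynomial (Fin q) R) (Fin r → MvPolynomial (Fin q) R)
  obtain ⟨f, hf⟩ := exists_dependent_seq (α := fun _ => α)
    (G := fun k a => (∀ v ∈ a.2.2, ∀ m, gradedComponent a.2.1 m v ∈ a.2.2) ∧
      (k = 0 → a = ⟨n, fun _ => 0, K₀⟩))
    (Q := fun _ a b => ∃ d : (Fin b.1 → MvPolynomial (Fin q) R) →ₗ[MvPolynomial (Fin q) R]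
      (Fin a.1 → MvPolynomial (Fin q) R), LinearMap.range d = a.2.2 ∧ LinearMap.ker d = b.2.2 ∧
        ∀ m v, gradedComponent a.2.1 m (d v) = d (gradedComponent b.2.1 m v))
    ⟨⟨n, fun _ => 0, K₀⟩, hK₀, fun _ => rfl⟩ (by
      rintro k ⟨r, δ, K⟩ ⟨hK, -⟩
      obtain ⟨r', δ', d, h₁, h₂⟩ := exists_graded_cover δ K hK
      refine ⟨⟨r', δ', LinearMap.ker d⟩, ⟨fun v hv m => ?_, fun h => absurd h k.succ_ne_zero⟩,
        d, h₁, rfl, h₂⟩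
      change d _ = 0
      have hv' : d v = 0 := hv
      rw [← h₂, hv', map_zero])
  have hf₀ := (hf 0).1.2 rfl
  choose D hD₁ hD₂ hD₃ using fun k => (hf k).2
  obtain ⟨f₀, f', rfl⟩ : ∃ f₀ : α, ∃ f' : ℕ → α, f = fun k => Nat.casesOn k f₀ f' :=
    ⟨f 0, fun k => f (k + 1), by ext1 k; cases k <;> rfl⟩
  obtain rfl : f₀ = ⟨n, fun _ => 0, K₀⟩ := hf₀
  let r : ℕ → ℕ := fun | 0 | 1 | 2 => 0 | 3 => n | k + 4 => (f' k).1
  let δ : ∀ k, Fin (r k) → ℕ := fun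
    | 0 | 1 | 2 => fun _ => 0
    | 3 => fun _ => 0
    | k + 4 => (f' k).2.1
  let d : ∀ k, (Fin (r (k + 1)) → MvPolynomial (Fin q) R) →ₗ[MvPolynomial (Fin q) R]
    (Fin (r k) → MvPolynomial (Fin q) R) := fun
    | 0 | 1 | 2 => 0
    | 3 => D 0
    | k + 4 => D (k + 1)
  let aug : ∀ k, (Fin (r k) → MvPolynomial (Fin q) R) →ₗ[R] N := fun
    | 0 | 1 | 2 => 0
    | 3 => ε
    | _ + 4 => 0
  have hsub : ∀ k < 3, Subsingleton (Fin (r k) → MvPolynomial (Fin q) R) := by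
    rintro (_ | _ | _ | k) hk
    iterate 3 exact inferInstanceAs (Subsingleton (Fin 0 → _))
    lia
  refine ⟨⟨r, δ, d, aug, ?_, ?_, ?_, hsub, ?_, ?_, ?_, fun _ => rfl⟩⟩
  · rintro (_ | _ | _ | _ | k) m v
    iterate 3 exact map_zero _
    · exact hD₃ 0 m v
    · exact hD₃ (k + 1) m v
  · have h0 : ∀ k, k + 1 < 3 → ∀ z, (z ∈ LinearMap.range (d (k + 1)) ↔
        d k z = 0 ∧ ∀ m, aug (k + 1) (gradedComponent (δ (k + 1)) m z) = 0) := by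
      intro k hk z
      have := hsub _ hk
      rw [Subsingleton.elim z 0]
      simp
    rintro (_ | _ | _ | k) z
    · exact h0 0 (by lia) z
    · exact h0 1 (by lia) z
    · have hz : z ∈ LinearMap.range (D 0) ↔ z ∈ K₀ := SetLike.ext_iff.1 (hD₁ 0) z
      exact Iff.trans hz ⟨fun h => ⟨rfl, h⟩, fun h => h.2⟩
    · have hz : z ∈ LinearMap.range (D (k + 1)) ↔ z ∈ LinearMap.ker (D k) :=
        SetLike.ext_iff.1 ((hD₁ (k + 1)).trans (hD₂ k).symm) z
      refine Iff.trans hz ⟨fun h => ⟨?_, fun _ => rfl⟩, fun h => ?_⟩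
      · cases k <;> exact h
      · cases k <;> exact h.1
  · rintro (_ | _ | _ | _ | k) j v
    iterate 3 exact (smul_zero _).symm
    · exact hεX j v
    · exact (smul_zero _).symm
  · rintro (_ | _ | _ | _ | k) hk
    iterate 3 rfl
    · exact absurd rfl hk
    · rfl
  · rintro (_ | _ | _ | _ | k) z
    iterate 3 exact ⟨0, map_zero _, rfl⟩
    · obtain ⟨w, hw⟩ := hπ (ε z)
      exact ⟨_, (hε w).1, (hε w).2.trans hw⟩
    · exact ⟨0, map_zero _, rfl⟩
  · intro z
    obtain ⟨w, hw⟩ := hπ z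
    exact ⟨_, (hε w).2.trans hw⟩

end GradedResolution

namespace GradedResolution

open MvPolynomial

variable {R : Type*} [CommRing R] {q : ℕ} {g : Fin q → R}

theorem mem_of_semilinear {r : ℕ} {V : Type*} [AddCommGroup V] [Module R V]
    (f : (Fin r → MvPolynomial (Fin q) R) →ₗ[R] V)
    (hf : ∀ j v, f ((X j : MvPolynomial (Fin q) R) • v) = g j • f v) (S : Submodule R V)
    (hS : ∀ l, f (Pi.single l 1) ∈ S) (v) : f v ∈ S := by
  rw [← Finset.univ_sum_single v, map_sum]
  refine Submodule.sum_mem _ fun l _ => ?_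
  rw [show Pi.single l (v l) = v l • (Pi.single l 1 : Fin r → MvPolynomial (Fin q) R) by
    rw [← Pi.single_smul, smul_eq_mul, mul_one]]
  generalize v l = p
  induction p using MvPolynomial.induction_on with
  | C a =>
    have : ∀ w : Fin r → MvPolynomial (Fin q) R, (C a : MvPolynomial (Fin q) R) • w = a • w :=
      fun w => by rw [← algebraMap_smul (MvPolynomial (Fin q) R) a w]; rfl
    rw [this, map_smul]
    exact S.smul_mem _ (hS l)
  | add p p' h h' =>
    rw [add_smul, map_add]
    exact S.add_mem h h'
  | mul_X p j h =>
    rw [mul_comm, mul_smul, hf]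
    exact S.smul_mem _ h

variable {N : Type*} [AddCommGroup N] [Module R N] (F : GradedResolution g N)

theorem d_d (k : ℕ) (z) : F.d k (F.d (k + 1) z) = 0 :=
  ((F.mem_range_iff k _).1 ⟨z, rfl⟩).1

theorem aug_gradedComponent_d (k m : ℕ) (z) :
    F.aug k (gradedComponent (F.δ k) m (F.d k z)) = 0 := by
  cases k with
  | zero => rw [F.aug_eq_zero 0 (by lia)]; rfl
  | succ k => exact ((F.mem_range_iff k _).1 ⟨z, rfl⟩).2 m

theorem aug_d (k : ℕ) (z) : F.aug k (F.d k z) = 0 := by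
  obtain ⟨K, hK⟩ := exists_sum_gradedComponent (F.δ k) (F.d k z)
  rw [hK, map_sum]
  exact Finset.sum_eq_zero fun m _ => F.aug_gradedComponent_d k m z

/-- The endomorphism of a graded resolution which evaluates the variables `X j` at `g j` and
lands in degree zero. -/
theorem exists_evaluation : ∃ φ : ∀ k, (Fin (F.r k) → MvPolynomial (Fin q) R) →ₗ[R]
      (Fin (F.r k) → MvPolynomial (Fin q) R),
    (∀ k j v, φ k ((X j : MvPolynomial (Fin q) R) • v) = g j • φ k v) ∧
    (∀ k v, gradedComponent (F.δ k) 0 (φ k v) = φ k v) ∧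
    (∀ k v, F.aug k (φ k v) = F.aug k v) ∧
    (∀ k v, F.d k (φ (k + 1) v) = φ k (F.d k v)) := by
  obtain ⟨φ, hφ⟩ := exists_dependent_seq
    (α := fun k => (Fin (F.r k) → MvPolynomial (Fin q) R) →ₗ[R]
      (Fin (F.r k) → MvPolynomial (Fin q) R))
    (G := fun k φ => (∀ j v, φ ((X j : MvPolynomial (Fin q) R) • v) = g j • φ v) ∧
      (∀ v, gradedComponent (F.δ k) 0 (φ v) = φ v) ∧ (∀ v, F.aug k (φ v) = F.aug k v) ∧
      ∀ z, φ (F.d k z) ∈ LinearMap.range (F.d k))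
    (Q := fun k φ φ' => ∀ v, F.d k (φ' v) = φ (F.d k v))
    ⟨0, fun _ _ => (smul_zero _).symm, fun _ => map_zero _,
      fun _ => by rw [F.aug_eq_zero 0 (by lia)]; rfl, fun _ => zero_mem _⟩ (by
    rintro k φ ⟨hX, h0, haug, hrange⟩
    have key (l : Fin (F.r (k + 1))) : ∃ u, gradedComponent (F.δ (k + 1)) 0 u = u ∧
        F.d k u = φ (F.d k (Pi.single l 1)) ∧
        F.aug (k + 1) u = F.aug (k + 1) (Pi.single l 1) := by
      by_cases hk : k + 1 = 3
      · obtain ⟨u, h₁, h₂⟩ := F.exists_degree_zero (k + 1) (Pi.single l 1)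
        have := F.subsingleton k (by lia)
        exact ⟨u, h₁, Subsingleton.elim _ _, h₂⟩
      · obtain ⟨w, hw⟩ := hrange (Pi.single l 1)
        refine ⟨gradedComponent (F.δ (k + 1)) 0 w, ?_, ?_, ?_⟩
        · rw [gradedComponent_gradedComponent, if_pos rfl]
        · rw [← F.gradedComponent_d, hw, h0]
        · rw [F.aug_eq_zero _ hk]; rfl
    choose u hu₁ hu₂ hu₃ using key
    let φ' : (Fin (F.r (k + 1)) → MvPolynomial (Fin q) R) →ₗ[R]
        (Fin (F.r (k + 1)) → MvPolynomial (Fin q) R) :=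
      Fintype.linearCombination R u ∘ₗ
        LinearMap.pi fun l => (aeval g).toLinearMap ∘ₗ LinearMap.proj l
    have hφ' (v) : φ' v = ∑ l, aeval g (v l) • u l := rfl
    have hφX (j v) : φ' ((X j : MvPolynomial (Fin q) R) • v) = g j • φ' v := by
      simp [hφ', Finset.smul_sum, mul_smul]
    have hφ₁ (l) : φ' (Pi.single l 1) = u l := by
      rw [hφ', Finset.sum_eq_single l]
      · simp
      · intro l' _ hl
        rw [Pi.single_eq_of_ne hl, map_zero, zero_smul]
      · simp
    have h0' (v) : gradedComponent (F.δ (k + 1)) 0 (φ' v) = φ' v := by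
      have := mem_of_semilinear φ' hφX
        (LinearMap.ker (gradedComponent (F.δ (k + 1)) 0 - LinearMap.id)) (fun l => by
          rw [LinearMap.mem_ker, LinearMap.sub_apply, hφ₁, hu₁, LinearMap.id_apply, sub_self]) v
      exact sub_eq_zero.1 this
    have haug' (v) : F.aug (k + 1) (φ' v) = F.aug (k + 1) v := by
      have := mem_of_semilinear (F.aug (k + 1) ∘ₗ φ' - F.aug (k + 1)) (g := g)
        (fun j v => by
          simp only [LinearMap.sub_apply, LinearMap.comp_apply, hφX, map_smul, F.aug_X, smul_sub])
        ⊥ (fun l => by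
          rw [Submodule.mem_bot, LinearMap.sub_apply, LinearMap.comp_apply, hφ₁, hu₃, sub_self]) v
      exact sub_eq_zero.1 this
    have hd' (v) : F.d k (φ' v) = φ (F.d k v) := by
      have := mem_of_semilinear ((F.d k).restrictScalars R ∘ₗ φ' -
          φ ∘ₗ (F.d k).restrictScalars R) (g := g)
        (fun j v => by
          simp only [LinearMap.sub_apply, LinearMap.comp_apply, hφX, map_smul, smul_sub,
            LinearMap.restrictScalars_apply, hX])
        ⊥ (fun l => by
          rw [Submodule.mem_bot]
          exact sub_eq_zero.2 ((congrArg _ (hφ₁ l)).trans (hu₂ l))) v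
      exact sub_eq_zero.1 this
    refine ⟨φ', ⟨hφX, h0', haug', fun z => (F.mem_range_iff k _).2 ⟨?_, fun m => ?_⟩⟩, hd'⟩
    · rw [hd', F.d_d, map_zero]
    · rw [gradedComponent_of_eq _ _ (h0' _)]
      split_ifs
      · rw [haug', F.aug_d]
      · exact map_zero _)
  exact ⟨φ, fun k => (hφ k).1.1, fun k => (hφ k).1.2.1, fun k => (hφ k).1.2.2.1,
    fun k => (hφ k).2⟩

/-- Multiplication by an element annihilating `N` is null-homotopic on a graded resolution. -/
theorem exists_homotopy (a : R) (ha : ∀ x : N, a • x = 0) :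
    ∃ s : ∀ k, (Fin (F.r k) → MvPolynomial (Fin q) R) →ₗ[MvPolynomial (Fin q) R]
      (Fin (F.r (k + 1)) → MvPolynomial (Fin q) R),
    (∀ k m v, gradedComponent (F.δ (k + 1)) m (s k v) = s k (gradedComponent (F.δ k) m v)) ∧
    ∀ k z, F.d (k + 1) (s (k + 1) z) + s k (F.d k z) = a • z := by
  obtain ⟨s, hs⟩ := exists_dependent_seq
    (α := fun k => (Fin (F.r k) → MvPolynomial (Fin q) R) →ₗ[MvPolynomial (Fin q) R]
      (Fin (F.r (k + 1)) → MvPolynomial (Fin q) R))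
    (G := fun k s =>
      (∀ m v, gradedComponent (F.δ (k + 1)) m (s v) = s (gradedComponent (F.δ k) m v)) ∧
      ∀ z, F.d k (s (F.d k z)) = a • F.d k z)
    (Q := fun k s s' => ∀ z, F.d (k + 1) (s' z) + s (F.d k z) = a • z)
    ⟨0, fun _ _ => map_zero _, fun _ => by
      have := F.subsingleton 0 (by lia)
      exact Subsingleton.elim _ _⟩ (by
    rintro k s ⟨hgr, hsd⟩
    have key (l : Fin (F.r (k + 1))) : ∃ u, gradedComponent (F.δ (k + 2)) (F.δ (k + 1) l) u = u ∧
        F.d (k + 1) u = a • (Pi.single l 1 : Fin _ → MvPolynomial (Fin q) R) -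
          s (F.d k (Pi.single l 1)) := by
      have hl : gradedComponent (F.δ (k + 1)) (F.δ (k + 1) l)
          (Pi.single l (1 : MvPolynomial (Fin q) R)) = Pi.single l 1 := by
        ext1 l'
        rw [gradedComponent_apply]
        by_cases h : l' = l
        · subst h
          rw [if_pos le_rfl, Pi.single_eq_same, Nat.sub_self, ← C_1, homogeneousComponent_C,
            if_pos rfl]
        · rw [Pi.single_eq_of_ne h, map_zero, ite_self]
      obtain ⟨w, hw⟩ : a • (Pi.single l 1 : Fin _ → MvPolynomial (Fin q) R) -
          s (F.d k (Pi.single l 1)) ∈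
          LinearMap.range (F.d (k + 1)) := by
        rw [F.mem_range_iff]
        constructor
        · rw [map_sub, hsd, LinearMap.map_smul_of_tower, sub_self]
        · intro m
          rw [map_sub, map_sub, map_smul, map_smul, ha, zero_sub, neg_eq_zero]
          by_cases hk : k + 1 = 3
          · have := F.subsingleton k (by lia)
            rw [Subsingleton.elim (F.d k (Pi.single l 1)) 0, map_zero, map_zero, map_zero]
          · rw [F.aug_eq_zero _ hk]; rfl
      refine ⟨gradedComponent (F.δ (k + 2)) (F.δ (k + 1) l) w, ?_, ?_⟩
      · rw [gradedComponent_gradedComponent, if_pos rfl]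
      · rw [← F.gradedComponent_d, hw, map_sub, map_smul, hgr, F.gradedComponent_d, hl]
    choose u hu₁ hu₂ using key
    let s' := Fintype.linearCombination (MvPolynomial (Fin q) R) u
    have hs' (z) : F.d (k + 1) (s' z) + s (F.d k z) = a • z := by
      have : F.d (k + 1) ∘ₗ s' + s ∘ₗ F.d k = a • LinearMap.id := by
        refine LinearMap.pi_ext' fun l => LinearMap.ext_ring ?_
        change F.d (k + 1) (s' (Pi.single l 1)) + s (F.d k (Pi.single l 1)) =
          a • (Pi.single l 1 : Fin _ → MvPolynomial (Fin q) R)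
        rw [Fintype.linearCombination_apply_single, one_smul, hu₂, sub_add_cancel]
      exact LinearMap.congr_fun this z
    refine ⟨s', ⟨gradedComponent_linearCombination _ hu₁, fun z => ?_⟩, hs'⟩
    have := hs' (F.d (k + 1) z)
    rwa [F.d_d, map_zero, add_zero] at this)
  exact ⟨s, fun k => (hs k).1.1, fun k => (hs k).2⟩

theorem map_aug_range_gradedComponent (m : ℕ) :
    (LinearMap.range (gradedComponent (F.δ 3) m)).map (F.aug 3) =
      Ideal.span (Set.range g) ^ m • (⊤ : Submodule R N) := by
  refine le_antisymm ?_ ?_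
  · rintro _ ⟨_, ⟨v, rfl⟩, rfl⟩
    rw [← Finset.univ_sum_single v, map_sum, map_sum]
    refine Submodule.sum_mem _ fun l _ => ?_
    rw [show Pi.single l (v l) = v l • (Pi.single l 1 : Fin _ → MvPolynomial (Fin q) R) by
      rw [← Pi.single_smul, smul_eq_mul, mul_one]]
    generalize v l = p
    induction p using MvPolynomial.induction_on generalizing m with
    | C a =>
      have : ∀ w : Fin (F.r 3) → MvPolynomial (Fin q) R, (C a : MvPolynomial (Fin q) R) • w =
        a • w := fun w => by rw [← algebraMap_smul (MvPolynomial (Fin q) R) a w]; rfl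
      rw [this, map_smul, map_smul]
      refine Submodule.smul_mem _ _ ?_
      cases m with
      | zero => rw [pow_zero, Ideal.one_eq_top, Submodule.top_smul]; trivial
      | succ m =>
        suffices gradedComponent (F.δ 3) (m + 1) (Pi.single l (1 : MvPolynomial (Fin q) R)) = 0 by
          rw [this, map_zero]
          exact zero_mem _
        ext1 l'
        rw [gradedComponent_apply, F.δ_three, if_pos (Nat.zero_le _), Pi.zero_apply]
        by_cases h : l' = l
        · subst h
          rw [Pi.single_eq_same, ← C_1, homogeneousComponent_C, if_neg (by lia)]
        · rw [Pi.single_eq_of_ne h, map_zero]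
    | add p p' h h' =>
      rw [add_smul, map_add, map_add]
      exact Submodule.add_mem _ (h m) (h' m)
    | mul_X p j h =>
      rw [mul_comm, mul_smul]
      cases m with
      | zero => rw [gradedComponent_zero_X_smul, map_zero]; exact zero_mem _
      | succ m =>
        rw [gradedComponent_succ_X_smul, F.aug_X, pow_succ', mul_smul]
        exact Submodule.smul_mem_smul (Ideal.subset_span ⟨j, rfl⟩) (h m)
  · induction m with
    | zero =>
      rintro x -
      obtain ⟨z, rfl⟩ := F.aug_surjective x
      obtain ⟨u, h₁, h₂⟩ := F.exists_degree_zero 3 z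
      exact ⟨u, ⟨u, h₁⟩, h₂⟩
    | succ m ih =>
      rw [pow_succ', mul_smul]
      refine (Submodule.smul_mono le_rfl ih).trans (Submodule.smul_le.2 ?_)
      rintro a ha _ ⟨_, ⟨v, rfl⟩, rfl⟩
      induction ha using Submodule.span_induction with
      | mem a ha =>
        obtain ⟨j, rfl⟩ := ha
        exact ⟨_, ⟨(X j : MvPolynomial (Fin q) R) • v, rfl⟩, by
          rw [gradedComponent_succ_X_smul, F.aug_X]⟩
      | zero => rw [zero_smul]; exact zero_mem _
      | add a b _ _ ha hb => rw [add_smul]; exact add_mem ha hb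
      | smul a b _ hb => rw [smul_assoc]; exact Submodule.smul_mem _ _ hb

end GradedResolution

section TensorNoetherian

open MvPolynomial TensorProduct

variable {R : Type*} [CommRing R] {q r : ℕ} (δ : Fin r → ℕ) (M : Type*) [AddCommGroup M]
  [Module R M]

/-- The action of the variable `X j` on the tensor product of a module with a free module over a
polynomial ring. -/
noncomputable def tensorX (r : ℕ) (j : Fin q) :
    Module.End R (M ⊗[R] (Fin r → MvPolynomial (Fin q) R)) :=
  LinearMap.lTensor M (LinearMap.lsmul (MvPolynomial (Fin q) R) _ (X j) |>.restrictScalars R)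

theorem tensorX_tmul (j : Fin q) (x : M) (v : Fin r → MvPolynomial (Fin q) R) :
    tensorX M r j (x ⊗ₜ v) = x ⊗ₜ ((X j : MvPolynomial (Fin q) R) • v) := rfl

/-- The degree `m` part of the tensor product of a module with a graded free module over a
polynomial ring. -/
noncomputable def tensorDegree (m : ℕ) : Submodule R (M ⊗[R] (Fin r → MvPolynomial (Fin q) R)) :=
  LinearMap.range (LinearMap.lTensor M (gradedComponent δ m))

theorem isNoetherianPair_tensorDegree [IsNoetherianRing R] [Module.Finite R M] {p : ℕ}
    (a : Fin p → R) :
    IsNoetherianPair (List.ofFn fun i => algebraMap R (Module.End R _) (a i))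
      (List.ofFn (tensorX (R := R) (q := q) M r)) ⊥
      (fun n m => Ideal.span (Set.range a) ^ n • tensorDegree δ M m) := by
  obtain ⟨t, e, he⟩ := Module.Finite.exists_fin (R := R) (M := M)
  let T := MvPolynomial (Fin q) R
  let S := MvPolynomial (Fin p) T
  let β (n : ℕ) : S →ₗ[T] T :=
    (aeval fun i => (C (a i) : T)).toLinearMap ∘ₗ homogeneousComponent n
  have hβ₀ (i) (s : S) : β 0 (X i * s) = 0 := by
    change aeval _ (homogeneousComponent 0 (X i * s)) = 0
    rw [homogeneousComponent_zero_X_mul, map_zero]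
  have hβ (n i) (s : S) : β (n + 1) (X i * s) = a i • β n s := by
    change aeval _ (homogeneousComponent (n + 1) (X i * s)) = _
    rw [homogeneousComponent_succ_X_mul, map_mul, aeval_X, ← smul_eq_C_mul]
    rfl
  have hβX (n j) (s : S) : β n (C (X j) * s) = X j * β n s := by
    rw [← smul_eq_C_mul, map_smul, smul_eq_mul]
  have hβC (n) (s : T) : β n (C s) = if n = 0 then s else 0 := by
    change aeval _ (homogeneousComponent n (C s)) = _
    rw [homogeneousComponent_C]
    split_ifs
    · rw [aeval_C]; rfl
    · rw [map_zero]
  let γ (n m : ℕ) (l : Fin t) : (Fin t × Fin r → S) →ₗ[R] (Fin r → T) :=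
    gradedComponent δ m ∘ₗ LinearMap.pi fun k =>
      (β n).restrictScalars R ∘ₗ LinearMap.proj (l, k)
  have hγ (n m l u) : γ n m l u = gradedComponent δ m (fun k => β n (u (l, k))) := rfl
  let θ (n m : ℕ) : (Fin t × Fin r → S) →ₗ[R] M ⊗[R] (Fin r → T) :=
    ∑ l, TensorProduct.mk R M (Fin r → T) (e l) ∘ₗ γ n m l
  have hθ (n m u) : θ n m u = ∑ l, e l ⊗ₜ[R] γ n m l u := by
    simp only [θ, LinearMap.sum_apply, LinearMap.comp_apply, TensorProduct.mk_apply]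
  have hx₀ (i m u) : θ 0 m ((X i : S) • u) = 0 := by
    rw [hθ]
    refine Finset.sum_eq_zero fun l _ => ?_
    simp only [hγ, Pi.smul_apply, smul_eq_mul, hβ₀]
    exact (congrArg _ (map_zero _)).trans (tmul_zero _ _)
  have hx (i n m u) : θ (n + 1) m ((X i : S) • u) = a i • θ n m u := by
    rw [hθ, hθ, Finset.smul_sum]
    refine Finset.sum_congr rfl fun l _ => ?_
    simp only [hγ, Pi.smul_apply, smul_eq_mul, hβ, ← tmul_smul, ← map_smul]
    rfl
  have hy₀ (j n u) : θ n 0 ((C (X j) : S) • u) = 0 := by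
    rw [hθ]
    refine Finset.sum_eq_zero fun l _ => ?_
    simp only [hγ, Pi.smul_apply, smul_eq_mul, hβX]
    exact (congrArg _ (gradedComponent_zero_X_smul δ _ j)).trans (tmul_zero _ _)
  have hy (j n m u) : θ n (m + 1) ((C (X j) : S) • u) = tensorX M r j (θ n m u) := by
    rw [hθ, hθ, map_sum]
    refine Finset.sum_congr rfl fun l _ => ?_
    simp only [hγ, Pi.smul_apply, smul_eq_mul, hβX, tensorX_tmul,
      ← gradedComponent_succ_X_smul]
    rfl
  refine isNoetherianPair_of_parametrization (fun i j => Algebra.commutes _ _) θ hx₀ hx hy₀ hy ?_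
  let B (n m : ℕ) : Submodule R (Fin t × Fin r → S) :=
    ⨅ (n') (m') (_ : (n', m') ≠ (n, m)), LinearMap.ker (θ n' m')
  have hB (n m u) : u ∈ B n m ↔ ∀ n' m', (n', m') ≠ (n, m) → θ n' m' u = 0 := by
    simp only [B, Submodule.mem_iInf, LinearMap.mem_ker]
  suffices ∀ n m, Ideal.span (Set.range a) ^ n • tensorDegree δ M m ≤ (B n m).map (θ n m) by
    intro n m z hz
    obtain ⟨u, hu, rfl⟩ := this n m hz
    exact ⟨u, rfl, (hB n m u).1 hu⟩
  intro n m
  induction n with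
  | zero =>
    rw [pow_zero, Ideal.one_eq_top, Submodule.top_smul]
    rintro _ ⟨z, rfl⟩
    induction z using TensorProduct.induction_on with
    | zero => rw [map_zero]; exact zero_mem _
    | add z z' h h' => rw [map_add]; exact add_mem h h'
    | tmul x v =>
      rw [LinearMap.lTensor_tmul]
      have hx : x ∈ Submodule.span R (Set.range e) := he ▸ Submodule.mem_top
      induction hx using Submodule.span_induction with
      | zero => rw [zero_tmul]; exact zero_mem _
      | add x x' _ _ h h' => rw [add_tmul]; exact add_mem h h'
      | smul c x _ h => rw [← smul_tmul']; exact Submodule.smul_mem _ c h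
      | mem x hx =>
        obtain ⟨l, rfl⟩ := hx
        have key (n' m') : θ n' m' (fun lk => if lk.1 = l then C (gradedComponent δ m v lk.2)
            else 0) = if n' = 0 then e l ⊗ₜ
              gradedComponent δ m' (gradedComponent δ m v) else 0 := by
          rw [hθ, Finset.sum_eq_single l]
          · simp only [hγ, if_true, hβC]
            split_ifs
            · rfl
            · exact (congrArg _ (map_zero _)).trans (tmul_zero _ _)
          · intro l' _ hl
            simp only [hγ, hl, if_false, map_zero]
            exact (congrArg _ (map_zero _)).trans (tmul_zero _ _)
          · simp
        refine ⟨_, (hB 0 m _).2 fun n' m' h => ?_, (key 0 m).trans ?_⟩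
        · rw [key]
          split_ifs with hn
          · rw [gradedComponent_gradedComponent, if_neg (fun hm => h (by rw [hn, hm])), tmul_zero]
          · rfl
        · rw [if_pos rfl, gradedComponent_gradedComponent, if_pos rfl]
  | succ n ih =>
    rw [pow_succ', mul_smul]
    refine (Submodule.smul_mono le_rfl ih).trans (Submodule.smul_le.2 ?_)
    rintro b hb _ ⟨u, hu, rfl⟩
    induction hb using Submodule.span_induction with
    | mem b hb =>
      obtain ⟨i, rfl⟩ := hb
      refine ⟨(X i : S) • u, (hB _ _ _).2 ?_, hx i n m u⟩
      rintro (_ | n') m' h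
      · exact hx₀ i m' u
      · rw [hx, (hB n m u).1 hu n' m' (by rintro ⟨⟩; exact h rfl), smul_zero]
    | zero => rw [zero_smul]; exact zero_mem _
    | add a b _ _ ha hb => rw [add_smul]; exact add_mem ha hb
    | smul a b _ hb => rw [smul_assoc]; exact Submodule.smul_mem _ _ hb

end TensorNoetherian

section FiniteLengthTensor

open TensorProduct IsLocalRing

variable {R : Type*} [CommRing R] [IsLocalRing R]

theorem IsFiniteLength.exists_maximalIdeal_pow_le_annihilator {V : Type*} [AddCommGroup V]
    [Module R V] (h : IsFiniteLength R V) :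
    ∃ c, maximalIdeal R ^ c ≤ Module.annihilator R V := by
  obtain ⟨_, _⟩ := isFiniteLength_iff_isNoetherian_isArtinian.1 h
  obtain ⟨c, hc⟩ := IsArtinian.monotone_stabilizes (R := R) (M := V)
    ⟨fun c => OrderDual.toDual (maximalIdeal R ^ c • ⊤), fun a b hab =>
      Submodule.smul_mono (Ideal.pow_le_pow_right hab) le_rfl⟩
  have h₁ : maximalIdeal R ^ c • (⊤ : Submodule R V) =
      maximalIdeal R • maximalIdeal R ^ c • (⊤ : Submodule R V) := by
    rw [← mul_smul, ← pow_succ']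
    exact hc (c + 1) c.le_succ
  have h₂ : maximalIdeal R ^ c • (⊤ : Submodule R V) = ⊥ :=
    Submodule.eq_bot_of_le_smul_of_le_jacobson_bot _ _ (IsNoetherian.noetherian _) h₁.le
      (maximalIdeal_le_jacobson _)
  refine ⟨c, fun r hr => Module.mem_annihilator.2 fun v => ?_⟩
  exact (Submodule.mem_bot R).1 (h₂ ▸ Submodule.smul_mem_smul hr trivial)

theorem Module.mem_support_tensorProduct {R M N : Type*} [CommRing R] [AddCommGroup M]
    [Module R M] [Module.Finite R M] [AddCommGroup N] [Module R N] [Module.Finite R N]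
    {p : PrimeSpectrum R} (hM : p ∈ Module.support R M) (hN : p ∈ Module.support R N) :
    p ∈ Module.support R (M ⊗[R] N) := by
  rw [Module.mem_support_iff_nontrivial_residueField_tensorProduct] at hM hN ⊢
  exact (AlgebraTensorModule.distribBaseChange R p.asIdeal.ResidueField M N).nontrivial

theorem exists_maximalIdeal_pow_le_sup_annihilator [IsNoetherianRing R] {M N : Type*}
    [AddCommGroup M]
    [Module R M] [Module.Finite R M] [AddCommGroup N] [Module R N] [Module.Finite R N]
    (h : IsFiniteLength R (M ⊗[R] N)) :
    ∃ c, maximalIdeal R ^ c ≤ Module.annihilator R M ⊔ Module.annihilator R N := by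
  obtain ⟨c, hc⟩ := h.exists_maximalIdeal_pow_le_annihilator
  refine Ideal.exists_pow_le_of_le_radical_of_fg ?_ (IsNoetherian.noetherian _)
  rw [Ideal.radical_eq_sInf]
  refine le_sInf fun p ⟨hp, hprime⟩ => ?_
  have := Module.mem_support_tensorProduct (p := ⟨p, hprime⟩)
    (Module.mem_support_iff_of_finite.2 (le_sup_left.trans hp) : _ ∈ Module.support R M)
    (Module.mem_support_iff_of_finite.2 (le_sup_right.trans hp) : _ ∈ Module.support R N)
  exact hprime.le_of_pow_le (hc.trans (Module.mem_support_iff_of_finite.1 this))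

end FiniteLengthTensor

section ResolutionSystem

open TensorProduct IsLocalRing MvPolynomial

variable {R : Type*} [CommRing R]

theorem tensorDegree_map_le {q r r' : ℕ} {δ : Fin r → ℕ} {δ' : Fin r' → ℕ} {m m' : ℕ}
    (M : Type*) [AddCommGroup M] [Module R M]
    (f : (Fin r → MvPolynomial (Fin q) R) →ₗ[R] (Fin r' → MvPolynomial (Fin q) R))
    (h : ∀ v, gradedComponent δ' m' (f (gradedComponent δ m v)) = f (gradedComponent δ m v)) :
    (tensorDegree δ M m).map (LinearMap.lTensor M f) ≤ tensorDegree δ' M m' := by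
  have hf : gradedComponent δ' m' ∘ₗ f ∘ₗ gradedComponent δ m = f ∘ₗ gradedComponent δ m :=
    LinearMap.ext h
  rintro _ ⟨_, ⟨z, rfl⟩, rfl⟩
  refine ⟨LinearMap.lTensor M (f ∘ₗ gradedComponent δ m) z, ?_⟩
  rw [← LinearMap.comp_apply, ← LinearMap.lTensor_comp, hf, LinearMap.lTensor_comp]
  rfl

theorem fg_tensorDegree [IsNoetherianRing R] {q r : ℕ} (δ : Fin r → ℕ) (M : Type*)
    [AddCommGroup M] [Module R M]
    [Module.Finite R M] (m : ℕ) : (tensorDegree (R := R) (q := q) δ M m).FG := by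
  have : Module.Finite R (LinearMap.range (gradedComponent (R := R) (q := q) δ m)) :=
    Module.Finite.iff_fg.2 (fg_range_gradedComponent δ m)
  have h : tensorDegree (R := R) (q := q) δ M m =
      LinearMap.range (LinearMap.lTensor M (LinearMap.range (gradedComponent δ m)).subtype) := by
    conv_lhs => rw [tensorDegree, ← LinearMap.subtype_comp_codRestrict (gradedComponent δ m) _
      (LinearMap.mem_range_self _),
      LinearMap.lTensor_comp]
    rw [LinearMap.range_comp_of_range_eq_top]
    exact LinearMap.range_eq_top.2 (LinearMap.lTensor_surjective _
      (LinearMap.surjective_rangeRestrict _))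
  rw [h, ← Module.Finite.iff_fg]
  infer_instance

/-- The tensor product of a finitely generated module with a graded resolution as a filtered
system. -/
theorem GradedResolution.exists_filteredSystem [IsLocalRing R] [IsNoetherianRing R] {p q : ℕ}
    {g : Fin q → R}
    {N : Type*} [AddCommGroup N] [Module R N] [Module.Finite R N] (F : GradedResolution g N)
    (M : Type*) [AddCommGroup M] [Module R M] [Module.Finite R M] (a : Fin p → R)
    (ha : ∀ i, a i ∈ maximalIdeal R) (hg : ∀ j, g j ∈ maximalIdeal R)
    (h : IsFiniteLength R (M ⊗[R] N))
    {φ : ∀ k, (Fin (F.r k) → MvPolynomial (Fin q) R) →ₗ[R]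
      (Fin (F.r k) → MvPolynomial (Fin q) R)}
    (hφX : ∀ k j v, φ k ((X j : MvPolynomial (Fin q) R) • v) = g j • φ k v)
    (hφ₀ : ∀ k v, gradedComponent (F.δ k) 0 (φ k v) = φ k v)
    (hφd : ∀ k v, F.d k (φ (k + 1) v) = φ k (F.d k v)) :
    ∃ S : FilteredSystem (Ideal.span (Set.range a)) a g
      (fun k => M ⊗[R] (Fin (F.r k) → MvPolynomial (Fin q) R)),
      (∀ k, S.d k = LinearMap.lTensor M ((F.d k).restrictScalars R)) ∧
      (∀ k, S.φ k = LinearMap.lTensor M (φ k)) ∧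
      ∀ m k, S.W m k = tensorDegree (F.δ k) M m := by
  have hI : Ideal.span (Set.range a) ≤ maximalIdeal R :=
    Ideal.span_le.2 (Set.range_subset_iff.2 ha)
  have hcomp (k) : (F.d k).restrictScalars R ∘ₗ (F.d (k + 1)).restrictScalars R = 0 :=
    LinearMap.ext fun z => F.d_d k z
  have hdφ (k) : (F.d k).restrictScalars R ∘ₗ φ (k + 1) = φ k ∘ₗ (F.d k).restrictScalars R :=
    LinearMap.ext fun z => hφd k z
  refine ⟨{
    d := fun k => LinearMap.lTensor M ((F.d k).restrictScalars R)
    φ := fun k => LinearMap.lTensor M (φ k)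
    y := fun k => tensorX M (F.r k)
    W := fun m k => tensorDegree (F.δ k) M m
    a_mem := fun i => Ideal.subset_span ⟨i, rfl⟩
    le_maximalIdeal := hI
    g_mem := hg
    d_d := fun k z => ?_
    d_φ := fun k z => ?_
    d_y := fun k j z => ?_
    φ_y := fun k j z => ?_
    y_y := fun k i j z => ?_
    map_d := fun m k => ?_
    map_φ := fun m k => ?_
    map_y := fun m k j => ?_
    fg := fun m k => fg_tensorDegree _ _ _
    noetherian := fun k => isNoetherianPair_tensorDegree _ _ _
    annihilation := fun k => ?_ }, fun _ => rfl, fun _ => rfl, fun _ _ => rfl⟩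
  · rw [← LinearMap.comp_apply, ← LinearMap.lTensor_comp, hcomp, LinearMap.lTensor_zero]
    rfl
  · rw [← LinearMap.comp_apply, ← LinearMap.lTensor_comp, hdφ, LinearMap.lTensor_comp]
    rfl
  · induction z using TensorProduct.induction_on with
    | zero => simp only [map_zero]
    | add z z' h h' => simp only [map_add, h, h']
    | tmul x v => simp only [tensorX_tmul, LinearMap.lTensor_tmul,
        LinearMap.restrictScalars_apply, map_smul]
  · induction z using TensorProduct.induction_on with
    | zero => simp only [map_zero, smul_zero]
    | add z z' h h' => simp only [map_add, smul_add, h, h']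
    | tmul x v => simp only [tensorX_tmul, LinearMap.lTensor_tmul, hφX, tmul_smul]
  · induction z using TensorProduct.induction_on with
    | zero => simp only [map_zero]
    | add z z' h h' => simp only [map_add, h, h']
    | tmul x v => simp only [tensorX_tmul, smul_comm (X i : MvPolynomial (Fin q) R)]
  · refine tensorDegree_map_le M _ fun v => ?_
    change gradedComponent _ m (F.d k _) = F.d k _
    rw [F.gradedComponent_d, gradedComponent_gradedComponent, if_pos rfl]
  · exact tensorDegree_map_le M _ fun v => hφ₀ _ _
  · refine tensorDegree_map_le M _ fun v => ?_
    change gradedComponent _ (m + 1) ((X j : MvPolynomial (Fin q) R) • _) =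
      (X j : MvPolynomial (Fin q) R) • _
    rw [gradedComponent_succ_X_smul, gradedComponent_gradedComponent, if_pos rfl]
  · obtain ⟨c, hc⟩ := exists_maximalIdeal_pow_le_sup_annihilator h
    refine ⟨c, fun n m => Submodule.smul_le.2 fun b hb z hz => ?_⟩
    obtain ⟨b₁, hb₁, b₂, hb₂, rfl⟩ := Submodule.mem_sup.1 (hc hb)
    rw [add_smul]
    refine add_mem ?_ ?_
    · suffices b₁ • z = 0 by rw [this]; exact zero_mem _
      clear hz
      induction z using TensorProduct.induction_on with
      | zero => rw [smul_zero]
      | add z z' h h' => rw [smul_add, h, h', add_zero]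
      | tmul x v => rw [smul_tmul', Module.mem_annihilator.1 hb₁, zero_tmul]
    · obtain ⟨s, hs, hsd⟩ := F.exists_homotopy b₂ (Module.mem_annihilator.1 hb₂)
      have hs' : (F.d (k + 1)).restrictScalars R ∘ₗ (s (k + 1)).restrictScalars R +
          (s k).restrictScalars R ∘ₗ (F.d k).restrictScalars R = b₂ • LinearMap.id :=
        LinearMap.ext fun z => hsd k z
      refine ⟨LinearMap.lTensor M ((s (k + 1)).restrictScalars R) z, ?_, ?_⟩
      · have hz₁ := Submodule.mem_map_of_mem
          (f := LinearMap.lTensor M ((s (k + 1)).restrictScalars R)) hz.1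
        rw [Submodule.map_smul''] at hz₁
        refine Submodule.smul_mono le_rfl (tensorDegree_map_le M _ fun v => ?_) hz₁
        change gradedComponent _ m (s (k + 1) _) = s (k + 1) _
        rw [hs, gradedComponent_gradedComponent, if_pos rfl]
      · have := LinearMap.congr_fun (congrArg (LinearMap.lTensor M) hs') z
        rw [LinearMap.lTensor_add, LinearMap.lTensor_comp, LinearMap.lTensor_comp,
          LinearMap.lTensor_smul, LinearMap.lTensor_id] at this
        have hz₀ : LinearMap.lTensor M ((F.d k).restrictScalars R) z = 0 := hz.2
        simpa only [LinearMap.add_apply, LinearMap.comp_apply, hz₀, map_zero, add_zero,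
          LinearMap.smul_apply, LinearMap.id_apply] using this

end ResolutionSystem

section TorLength

open TensorProduct

variable {R : Type} [CommRing R]

theorem length_moduleCat_homology (S : ShortComplex (ModuleCat.{0} R)) :
    Module.length R S.homology = relLength (LinearMap.range S.f.hom) (LinearMap.ker S.g.hom) := by
  rw [S.moduleCatHomologyIso.toLinearEquiv.length_eq, relLength]
  have : LinearMap.range S.moduleCatToCycles =
      (LinearMap.range S.f.hom).submoduleOf (LinearMap.ker S.g.hom) := by
    ext z
    constructor
    · rintro ⟨x, rfl⟩
      exact ⟨x, rfl⟩
    · rintro ⟨x, hx⟩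
      exact ⟨x, Subtype.ext hx⟩
  exact (Submodule.quotEquivOfEq _ _ this).length_eq

variable {B : Type} [AddCommGroup B] [Module R B] {P : ℕ → Type} [∀ j, AddCommGroup (P j)]
  [∀ j, Module R (P j)] [∀ j, Module.Projective R (P j)]

theorem modLength_TorM (A : Type) [AddCommGroup A] [Module R A]
    (D : ∀ j, P (j + 1) →ₗ[R] P j) (η : P 1 →ₗ[R] B)
    (h₀ : Subsingleton (P 0)) (hη : Function.Surjective η)
    (hη₁ : LinearMap.range (D 1) = LinearMap.ker η)
    (hD : ∀ j, LinearMap.range (D (j + 2)) = LinearMap.ker (D (j + 1))) (i : ℕ) :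
    modLength R (TorM R i A B) = relLength (LinearMap.range (LinearMap.lTensor A (D (i + 1))))
      (LinearMap.ker (LinearMap.lTensor A (D i))) := by
  have hDD (j) : D (j + 1) ∘ₗ D (j + 1 + 1) = 0 := LinearMap.range_le_ker_iff.1 (hD j).le
  have hηD : η ∘ₗ D 1 = 0 := LinearMap.range_le_ker_iff.1 hη₁.le
  let K : ChainComplex (ModuleCat.{0} R) ℕ := ChainComplex.of
    (fun j => ModuleCat.of R (P (j + 1))) (fun j => ModuleCat.ofHom (D (j + 1)))
    (fun j => by rw [← ModuleCat.ofHom_comp, hDD]; rfl)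
  have hK (j) : K.d (j + 1) j = ModuleCat.ofHom (D (j + 1)) := by simp [K]
  let π : K ⟶ (ChainComplex.single₀ (ModuleCat.{0} R)).obj (ModuleCat.of R B) :=
    (ChainComplex.toSingle₀Equiv _ _).symm ⟨ModuleCat.ofHom η, by
      rw [hK]; exact (ModuleCat.ofHom_comp _ _).symm.trans (by rw [hηD]; rfl)⟩
  let Q : ProjectiveResolution (ModuleCat.of R B) :=
    { complex := K
      projective := fun n => (IsProjective.iff_projective (R := R) (P (n + 1))).1 inferInstance
      π := π
      quasiIso := ⟨fun n => by
        cases n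
        · rw [ChainComplex.quasiIsoAt₀_iff, ShortComplex.quasiIso_iff_of_zeros']
          · refine (ShortComplex.exact_and_epi_g_iff_of_iso
              (S₂ := ShortComplex.mk (ModuleCat.ofHom (D 1))
                (ModuleCat.ofHom η)
                (by rw [← ModuleCat.ofHom_comp, hηD]; rfl)) ?_).2
              ⟨(ShortComplex.moduleCat_exact_iff_range_eq_ker _).2 hη₁,
                (ModuleCat.epi_iff_surjective _).2 hη⟩
            exact ShortComplex.isoMk (Iso.refl _) (Iso.refl _) (Iso.refl _)
              ((Category.id_comp _).trans ((hK 0).symm.trans (Category.comp_id _).symm))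
              (by simp [π]; rfl)
          all_goals rfl
        · rw [quasiIsoAt_iff_exactAt']
          · rename_i n
            rw [HomologicalComplex.exactAt_iff' K (n + 2) (n + 1) n (by simp) (by simp),
              ShortComplex.moduleCat_exact_iff_range_eq_ker]
            exact (congrArg (fun f => LinearMap.range (ModuleCat.Hom.hom f)) (hK (n + 1))).trans
              ((hD n).trans (congrArg (fun f => LinearMap.ker (ModuleCat.Hom.hom f)) (hK n)).symm)
          · apply ChainComplex.exactAt_succ_single_obj⟩ }
  let L := (((MonoidalCategory.tensoringLeft (ModuleCat.{0} R)).obj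
    (ModuleCat.of R A)).mapHomologicalComplex (ComplexShape.down ℕ)).obj K
  have hL (j) : L.d (j + 1) j = ModuleCat.ofHom (LinearMap.lTensor A (D (j + 1))) :=
    congrArg (((MonoidalCategory.tensoringLeft (ModuleCat.{0} R)).obj (ModuleCat.of R A)).map)
      (hK j)
  have e := Q.isoLeftDerivedObj
    ((MonoidalCategory.tensoringLeft (ModuleCat.{0} R)).obj (ModuleCat.of R A)) i
  have hlen : Module.length R (TorM R i A B) = Module.length R (L.homology i) :=
    e.toLinearEquiv.length_eq
  rw [modLength, ← Module.coe_length, hlen]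
  congr 1
  have hf : LinearMap.range (L.d (i + 1) i).hom =
      LinearMap.range (LinearMap.lTensor A (D (i + 1))) := by rw [hL]; rfl
  cases i with
  | zero =>
    rw [(L.homologyIsoSc' 1 0 0 (by simp) (by simp)).toLinearEquiv.length_eq,
      length_moduleCat_homology]
    have hg : LinearMap.ker (L.d 0 0).hom = LinearMap.ker (LinearMap.lTensor A (D 0)) := by
      rw [L.shape 0 0 (by simp), Subsingleton.elim (D 0) 0, LinearMap.lTensor_zero]
      exact LinearMap.ker_zero.trans LinearMap.ker_zero.symm
    exact congrArg₂ relLength hf hg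
  | succ i =>
    rw [(L.homologyIsoSc' (i + 2) (i + 1) i (by simp) (by simp)).toLinearEquiv.length_eq,
      length_moduleCat_homology]
    have hg : LinearMap.ker (L.d (i + 1) i).hom =
        LinearMap.ker (LinearMap.lTensor A (D (i + 1))) := by rw [hL]; rfl
    exact congrArg₂ relLength hf hg

end TorLength

section ConeResolution

open MvPolynomial

namespace GradedResolution

variable {R : Type*} [CommRing R] {q : ℕ} {g : Fin q → R} {N : Type*} [AddCommGroup N] [Module R N]
  (F : GradedResolution g N)

/-- The projection of the cone of `φ` onto its part of bidegree `(0, m)`. -/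
noncomputable def coneComponent (m k : ℕ) :
    ((Fin (F.r (k + 1)) → MvPolynomial (Fin q) R) × (Fin (F.r k) → MvPolynomial (Fin q) R)) →ₗ[R]
      (Fin (F.r (k + 1)) → MvPolynomial (Fin q) R) × (Fin (F.r k) → MvPolynomial (Fin q) R) :=
  (gradedComponent (F.δ (k + 1)) 0).prodMap (gradedComponent (F.δ k) m)

theorem coneComponent_coneComponent (m k : ℕ) (z) :
    F.coneComponent m k (F.coneComponent m k z) = F.coneComponent m k z := by
  refine Prod.ext ?_ ?_
  · exact (gradedComponent_gradedComponent _ _ _ _).trans (if_pos rfl)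
  · exact (gradedComponent_gradedComponent _ _ _ _).trans (if_pos rfl)

theorem coneComponent_eq_of_mem {m k : ℕ} {z} (hz : z ∈ LinearMap.range (F.coneComponent m k)) :
    F.coneComponent m k z = z := by
  obtain ⟨w, rfl⟩ := hz
  exact F.coneComponent_coneComponent m k w

instance projective_range_coneComponent (m k : ℕ) :
    Module.Projective R (LinearMap.range (F.coneComponent m k)) :=
  .of_split (LinearMap.range (F.coneComponent m k)).subtype (F.coneComponent m k).rangeRestrict
    (LinearMap.ext fun z => Subtype.ext (F.coneComponent_eq_of_mem z.2))

variable (φ : ∀ k, (Fin (F.r k) → MvPolynomial (Fin q) R) →ₗ[R]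
  (Fin (F.r k) → MvPolynomial (Fin q) R))

/-- The differential of the cone of `φ`. -/
noncomputable def coneD (k : ℕ) :
    ((Fin (F.r (k + 2)) → MvPolynomial (Fin q) R) ×
      (Fin (F.r (k + 1)) → MvPolynomial (Fin q) R)) →ₗ[R]
      (Fin (F.r (k + 1)) → MvPolynomial (Fin q) R) × (Fin (F.r k) → MvPolynomial (Fin q) R) :=
  (((F.d (k + 1)).restrictScalars R).coprod (φ (k + 1))).prod
    (-((F.d k).restrictScalars R ∘ₗ LinearMap.snd R _ _))

theorem coneD_apply (k : ℕ) (z) :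
    F.coneD φ k z = (F.d (k + 1) z.1 + φ (k + 1) z.2, -F.d k z.2) := rfl

variable {φ}

theorem coneD_mem (hφ₀ : ∀ k v, gradedComponent (F.δ k) 0 (φ k v) = φ k v) (m k : ℕ) {z}
    (hz : z ∈ LinearMap.range (F.coneComponent m (k + 1))) :
    F.coneD φ k z ∈ LinearMap.range (F.coneComponent m k) := by
  have h := F.coneComponent_eq_of_mem hz
  have h₁ : gradedComponent _ _ z.1 = z.1 := congrArg Prod.fst h
  have h₂ : gradedComponent _ _ z.2 = z.2 := congrArg Prod.snd h
  refine ⟨F.coneD φ k z, Prod.ext ?_ ?_⟩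
  · change gradedComponent _ _ (F.d (k + 1) z.1 + φ (k + 1) z.2) = F.d (k + 1) z.1 + φ (k + 1) z.2
    rw [map_add, F.gradedComponent_d, h₁, hφ₀]
  · change gradedComponent _ _ (-F.d k z.2) = -F.d k z.2
    rw [map_neg, F.gradedComponent_d, h₂]

/-- The differential of the cone of `φ`, in bidegree `(0, m)`. -/
noncomputable def coneDRestrict (hφ₀ : ∀ k v, gradedComponent (F.δ k) 0 (φ k v) = φ k v)
    (m k : ℕ) : LinearMap.range (F.coneComponent m (k + 1)) →ₗ[R]
      LinearMap.range (F.coneComponent m k) :=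
  (F.coneD φ k).restrict fun _ hz => F.coneD_mem hφ₀ m k hz

/-- The augmentation of the cone of `φ`, in bidegree `(0, m)`. -/
noncomputable def coneAug (m : ℕ) : LinearMap.range (F.coneComponent m 2) →ₗ[R]
    N ⧸ (Ideal.span (Set.range g) ^ m • (⊤ : Submodule R N)) :=
  (Submodule.mkQ _ ∘ₗ F.aug 3 ∘ₗ LinearMap.fst R _ _) ∘ₗ Submodule.subtype _

theorem coneAug_surjective (m : ℕ) : Function.Surjective (F.coneAug m) := by
  intro x
  obtain ⟨x, rfl⟩ := Submodule.mkQ_surjective _ x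
  obtain ⟨z, rfl⟩ := F.aug_surjective x
  obtain ⟨u, h₁, h₂⟩ := F.exists_degree_zero 3 z
  exact ⟨⟨(u, 0), (u, 0), Prod.ext h₁ (map_zero (gradedComponent _ _))⟩,
    congrArg (Submodule.mkQ _) h₂⟩

variable (hφ₀ : ∀ k v, gradedComponent (F.δ k) 0 (φ k v) = φ k v)

theorem range_coneDRestrict_two (hφ : ∀ k v, F.aug k (φ k v) = F.aug k v) (m : ℕ) :
    LinearMap.range (F.coneDRestrict hφ₀ m 2) = LinearMap.ker (F.coneAug m) := by
  have := F.subsingleton 2 (by lia)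
  refine le_antisymm ?_ ?_
  · rintro _ ⟨z, rfl⟩
    have h₂ : gradedComponent _ _ z.1.2 = z.1.2 := congrArg Prod.snd (F.coneComponent_eq_of_mem z.2)
    refine (Submodule.Quotient.mk_eq_zero _).2 ?_
    change F.aug 3 (F.d 3 z.1.1 + φ 3 z.1.2) ∈ _
    rw [map_add, F.aug_d, hφ, zero_add, ← F.map_aug_range_gradedComponent]
    exact ⟨_, ⟨_, h₂⟩, rfl⟩
  · intro z hz
    have h := F.coneComponent_eq_of_mem z.2
    have h₁ : gradedComponent _ _ z.1.1 = z.1.1 := congrArg Prod.fst h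
    have hz : F.aug 3 z.1.1 ∈ _ := (Submodule.Quotient.mk_eq_zero _).1 hz
    rw [← F.map_aug_range_gradedComponent] at hz
    obtain ⟨w, ⟨v, hv⟩, hw⟩ := hz
    have hw₁ : gradedComponent (F.δ 3) m w = w := by
      rw [← hv, gradedComponent_gradedComponent, if_pos rfl]
    have hu₀ : gradedComponent (F.δ 3) 0 (z.1.1 - φ 3 w) = z.1.1 - φ 3 w := by
      rw [map_sub, h₁, hφ₀]
    obtain ⟨u, hu⟩ := (F.mem_range_iff 2 (z.1.1 - φ 3 w)).2 ⟨Subsingleton.elim _ _, fun k => by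
      rw [gradedComponent_of_eq _ _ hu₀]
      split_ifs
      · rw [map_sub, hφ, hw, sub_self]
      · rw [map_zero]⟩
    refine ⟨⟨F.coneComponent m 3 (u, w), _, rfl⟩, Subtype.ext (Prod.ext ?_ (Subsingleton.elim _ _))⟩
    change F.d 3 (gradedComponent _ _ u) + φ 3 (gradedComponent _ _ w) = z.1.1
    rw [← F.gradedComponent_d, hu, hu₀, hw₁, sub_add_cancel]

theorem range_coneDRestrict (hφ : ∀ k v, F.aug k (φ k v) = F.aug k v)
    (hφd : ∀ k v, F.d k (φ (k + 1) v) = φ k (F.d k v)) (m k : ℕ) :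
    LinearMap.range (F.coneDRestrict hφ₀ m (k + 3)) =
      LinearMap.ker (F.coneDRestrict hφ₀ m (k + 2)) := by
  refine le_antisymm ?_ ?_
  · rintro _ ⟨z, rfl⟩
    refine Subtype.ext (Prod.ext ?_ ?_)
    · change F.d (k + 3) (F.d (k + 4) z.1.1 + φ (k + 4) z.1.2) + φ (k + 3) (-F.d (k + 3) z.1.2) = 0
      rw [map_add, F.d_d, hφd, map_neg, zero_add, add_neg_cancel]
    · change -F.d (k + 2) (-F.d (k + 3) z.1.2) = 0
      rw [map_neg, F.d_d, neg_zero, neg_zero]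
  · intro z hz
    have h := F.coneComponent_eq_of_mem z.2
    have h₁ : gradedComponent _ _ z.1.1 = z.1.1 := congrArg Prod.fst h
    have h₂ : gradedComponent _ _ z.1.2 = z.1.2 := congrArg Prod.snd h
    have hz := congrArg Subtype.val hz
    have hz₁ : F.d (k + 3) z.1.1 + φ (k + 3) z.1.2 = 0 := congrArg Prod.fst hz
    have hz₂ : -F.d (k + 2) z.1.2 = 0 := congrArg Prod.snd hz
    obtain ⟨w, hw⟩ := (F.mem_range_iff (k + 2) z.1.2).2 ⟨neg_eq_zero.1 hz₂, fun n => by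
      rw [gradedComponent_of_eq _ _ h₂]
      split_ifs
      · rw [← hφ, eq_neg_of_add_eq_zero_right hz₁, map_neg, F.aug_d, neg_zero]
      · rw [map_zero]⟩
    have hw' : F.d (k + 3) (gradedComponent (F.δ (k + 4)) m w) = z.1.2 := by
      rw [← F.gradedComponent_d, hw, h₂]
    have hu₀ : gradedComponent (F.δ (k + 4)) 0 (z.1.1 +
        φ (k + 4) (gradedComponent (F.δ (k + 4)) m w)) =
        z.1.1 + φ (k + 4) (gradedComponent (F.δ (k + 4)) m w) := by
      rw [map_add, h₁, hφ₀]
    obtain ⟨u, hu⟩ := (F.mem_range_iff (k + 3) (z.1.1 +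
        φ (k + 4) (gradedComponent (F.δ (k + 4)) m w))).2
      ⟨by rw [map_add, hφd, hw', hz₁], fun n => by rw [F.aug_eq_zero (k + 4) (by lia)]; rfl⟩
    refine ⟨⟨F.coneComponent m (k + 4) (u, -w), _, rfl⟩, Subtype.ext (Prod.ext ?_ ?_)⟩
    · change F.d (k + 4) (gradedComponent _ _ u) + φ (k + 4) (gradedComponent _ _ (-w)) = z.1.1
      rw [← F.gradedComponent_d, hu, hu₀, map_neg, map_neg, add_neg_cancel_right]
    · change -F.d (k + 3) (gradedComponent _ _ (-w)) = z.1.2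
      rw [map_neg, map_neg, hw', neg_neg]

end GradedResolution

end ConeResolution

universe v

section TensorQuotient

open TensorProduct

variable {R : Type*} [CommRing R] (I : Ideal R) (M : Type*) [AddCommGroup M] [Module R M]

theorem ker_rTensor_mkQ (P : Type*) [AddCommGroup P] [Module R P] :
    LinearMap.ker (LinearMap.rTensor P (I • (⊤ : Submodule R M)).mkQ) = I • ⊤ := by
  rw [(rTensor_exact P (f := (I • (⊤ : Submodule R M)).subtype)
    (g := (I • (⊤ : Submodule R M)).mkQ) (LinearMap.exact_iff.2 (by simp))
    (Submodule.mkQ_surjective _)).linearMap_ker_eq]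
  refine le_antisymm ?_ ?_
  · rintro _ ⟨z, rfl⟩
    induction z using TensorProduct.induction_on with
    | zero => rw [map_zero]; exact zero_mem _
    | add z z' h h' => rw [map_add]; exact add_mem h h'
    | tmul x v =>
      obtain ⟨x, hx⟩ := x
      change x ⊗ₜ[R] v ∈ _
      induction hx using Submodule.smul_induction_on' with
      | smul b hb x _ => rw [← smul_tmul']; exact Submodule.smul_mem_smul hb trivial
      | add x _ y _ h h' => rw [add_tmul]; exact add_mem h h'
  · refine Submodule.smul_le.2 fun b hb z _ => ?_
    induction z using TensorProduct.induction_on with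
    | zero => rw [smul_zero]; exact zero_mem _
    | add z z' h h' => rw [smul_add]; exact add_mem (h trivial) (h' trivial)
    | tmul x v => exact ⟨⟨b • x, Submodule.smul_mem_smul hb trivial⟩ ⊗ₜ v, rfl⟩

/-- The homology of a complex tensored with `M ⧸ I M`, in terms of the complex tensored
with `M`. -/
theorem relLength_lTensor_quotient {P₂ P₁ P₀ : Type v} [AddCommGroup P₂] [Module R P₂]
    [AddCommGroup P₁] [Module R P₁] [AddCommGroup P₀] [Module R P₀]
    (D : P₂ →ₗ[R] P₁) (D' : P₁ →ₗ[R] P₀) :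
    relLength (LinearMap.range (LinearMap.lTensor (M ⧸ I • (⊤ : Submodule R M)) D))
        (LinearMap.ker (LinearMap.lTensor (M ⧸ I • (⊤ : Submodule R M)) D')) =
      relLength (LinearMap.range (LinearMap.lTensor M D) ⊔ I • ⊤)
        ((I • (⊤ : Submodule R (M ⊗[R] P₀))).comap (LinearMap.lTensor M D')) := by
  have hs (P : Type v) [AddCommGroup P] [Module R P] :
      Function.Surjective (LinearMap.rTensor P (I • (⊤ : Submodule R M)).mkQ) :=
    LinearMap.rTensor_surjective P (Submodule.mkQ_surjective _)
  have hc {P P' : Type v} [AddCommGroup P] [Module R P] [AddCommGroup P'] [Module R P']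
      (f : P →ₗ[R] P') (z : M ⊗[R] P) :
      LinearMap.lTensor (M ⧸ I • (⊤ : Submodule R M)) f
        (LinearMap.rTensor P (I • ⊤ : Submodule R M).mkQ z) =
        LinearMap.rTensor P' (I • ⊤ : Submodule R M).mkQ (LinearMap.lTensor M f z) := by
    rw [← LinearMap.comp_apply, ← LinearMap.comp_apply, LinearMap.lTensor_comp_rTensor,
      LinearMap.rTensor_comp_lTensor]
  refine (relLength_congr (LinearMap.rTensor P₁ (I • (⊤ : Submodule R M)).mkQ) ?_ ?_ ?_).symm
  · intro z hz
    rw [LinearMap.mem_ker, hc, ← LinearMap.mem_ker, ker_rTensor_mkQ]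
    exact hz
  · intro z hz
    obtain ⟨z, rfl⟩ := hs _ z
    rw [LinearMap.mem_ker, hc, ← LinearMap.mem_ker, ker_rTensor_mkQ] at hz
    exact ⟨z, hz, by rw [sub_self]; exact zero_mem _⟩
  · intro z hz
    rw [← ker_rTensor_mkQ]
    constructor
    · rintro ⟨w, hw⟩
      obtain ⟨w, rfl⟩ := hs _ w
      rw [hc] at hw
      refine Submodule.mem_sup.2 ⟨_, ⟨w, rfl⟩, z - LinearMap.lTensor M D w, ?_,
        add_sub_cancel _ _⟩
      rw [LinearMap.mem_ker, map_sub, hw, sub_self]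
    · intro h
      obtain ⟨_, ⟨w, rfl⟩, u, hu, rfl⟩ := Submodule.mem_sup.1 h
      refine ⟨LinearMap.rTensor P₂ (I • (⊤ : Submodule R M)).mkQ w, ?_⟩
      rw [hc, map_add, LinearMap.mem_ker.1 hu, add_zero]

end TensorQuotient

section ConeTensor

open TensorProduct MvPolynomial

namespace GradedResolution

variable {R : Type*} [CommRing R] {q : ℕ} {g : Fin q → R} {N : Type*} [AddCommGroup N] [Module R N]
  (F : GradedResolution g N) (M : Type*) [AddCommGroup M] [Module R M]

/-- The inclusion of the tensor product of `M` with the bidegree `(0, m)` part of the cone. -/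
noncomputable def coneInclusion (m k : ℕ) : M ⊗[R] LinearMap.range (F.coneComponent m k) →ₗ[R]
    (M ⊗[R] (Fin (F.r (k + 1)) → MvPolynomial (Fin q) R)) ×
      (M ⊗[R] (Fin (F.r k) → MvPolynomial (Fin q) R)) :=
  (TensorProduct.prodRight R R M _ _).toLinearMap ∘ₗ
    LinearMap.lTensor M (LinearMap.range (F.coneComponent m k)).subtype

theorem coneInclusion_injective (m k : ℕ) : Function.Injective (F.coneInclusion M m k) := by
  refine (TensorProduct.prodRight R R M _ _).injective.comp
    (Function.LeftInverse.injective
      (g := LinearMap.lTensor M (F.coneComponent m k).rangeRestrict) fun z => ?_)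
  rw [← LinearMap.comp_apply, ← LinearMap.lTensor_comp]
  have h : (F.coneComponent m k).rangeRestrict ∘ₗ
      (LinearMap.range (F.coneComponent m k)).subtype = LinearMap.id :=
    LinearMap.ext fun z => Subtype.ext (F.coneComponent_eq_of_mem z.2)
  rw [h, LinearMap.lTensor_id]
  rfl

theorem range_coneInclusion (m k : ℕ) : LinearMap.range (F.coneInclusion M m k) =
    (tensorDegree (F.δ (k + 1)) M 0).prod (tensorDegree (F.δ k) M m) := by
  have h : F.coneInclusion M m k ∘ₗ LinearMap.lTensor M (F.coneComponent m k).rangeRestrict =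
      (LinearMap.lTensor M (gradedComponent (F.δ (k + 1)) 0)).prodMap
        (LinearMap.lTensor M (gradedComponent (F.δ k) m)) ∘ₗ
          (TensorProduct.prodRight R R M _ _).toLinearMap := by
    ext <;> rfl
  rw [← LinearMap.range_comp_of_range_eq_top (F.coneInclusion M m k)
    (LinearMap.range_eq_top.2 (LinearMap.lTensor_surjective M
      (LinearMap.surjective_rangeRestrict (F.coneComponent m k)))), h,
    LinearMap.range_comp_of_range_eq_top _ (LinearEquiv.range _), LinearMap.range_prodMap]
  rfl

variable {φ : ∀ k, (Fin (F.r k) → MvPolynomial (Fin q) R) →ₗ[R]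
  (Fin (F.r k) → MvPolynomial (Fin q) R)}
  (hφ₀ : ∀ k v, gradedComponent (F.δ k) 0 (φ k v) = φ k v)

theorem coneInclusion_coneDRestrict (m k : ℕ) (z) :
    F.coneInclusion M m k (LinearMap.lTensor M (F.coneDRestrict hφ₀ m k) z) =
      (LinearMap.lTensor M ((F.d (k + 1)).restrictScalars R) (F.coneInclusion M m (k + 1) z).1 +
        LinearMap.lTensor M (φ (k + 1)) (F.coneInclusion M m (k + 1) z).2,
        -LinearMap.lTensor M ((F.d k).restrictScalars R) (F.coneInclusion M m (k + 1) z).2) := by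
  induction z using TensorProduct.induction_on with
  | zero =>
    simp only [map_zero, Prod.fst_zero, Prod.snd_zero, add_zero, neg_zero]
    rfl
  | add z z' h h' =>
    rw [map_add, map_add, h, h', map_add]
    refine Prod.ext ?_ ?_
    · simp only [Prod.mk_add_mk, Prod.fst_add, Prod.snd_add, map_add]
      abel
    · simp only [Prod.mk_add_mk, Prod.snd_add, map_add, neg_add]
  | tmul x v =>
    change (x ⊗ₜ[R] (F.d (k + 1) v.1.1 + φ (k + 1) v.1.2), x ⊗ₜ[R] (-F.d k v.1.2)) =
      (x ⊗ₜ[R] F.d (k + 1) v.1.1 + x ⊗ₜ[R] φ (k + 1) v.1.2, -(x ⊗ₜ[R] F.d k v.1.2))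
    rw [tmul_add, tmul_neg]

end GradedResolution

end ConeTensor

section ConeHomology

open TensorProduct MvPolynomial

theorem Submodule.ideal_smul_prod {R E E' : Type*} [CommRing R] [AddCommGroup E] [Module R E]
    [AddCommGroup E'] [Module R E'] (I : Ideal R) (A : Submodule R E) (B : Submodule R E') :
    I • A.prod B = (I • A).prod (I • B) := by
  rw [LinearMap.prod_eq_sup_map, LinearMap.prod_eq_sup_map, Submodule.smul_sup,
    Submodule.map_smul'', Submodule.map_smul'']

theorem relLength_eq_zero {R E : Type*} [CommRing R] [AddCommGroup E] [Module R E]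
    [Subsingleton E] (D Z : Submodule R E) : relLength D Z = 0 := by
  rw [Subsingleton.elim D Z, relLength_self]

namespace GradedResolution

variable {R : Type*} [CommRing R] [IsLocalRing R] {I : Ideal R} {p q : ℕ} {a : Fin p → R}
  {g : Fin q → R} {N : Type*} [AddCommGroup N] [Module R N] (F : GradedResolution g N)
  (M : Type*) [AddCommGroup M] [Module R M]
  {φ : ∀ k, (Fin (F.r k) → MvPolynomial (Fin q) R) →ₗ[R] (Fin (F.r k) → MvPolynomial (Fin q) R)}
  (hφ₀ : ∀ k v, gradedComponent (F.δ k) 0 (φ k v) = φ k v)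

theorem relLength_lTensor_coneDRestrict
    (S : FilteredSystem I a g fun k => M ⊗[R] (Fin (F.r k) → MvPolynomial (Fin q) R))
    (hd : ∀ k, S.d k = LinearMap.lTensor M ((F.d k).restrictScalars R))
    (hφ : ∀ k, S.φ k = LinearMap.lTensor M (φ k))
    (hW : ∀ m k, S.W m k = tensorDegree (F.δ k) M m) (k n m : ℕ) :
    relLength
        (LinearMap.range (LinearMap.lTensor (M ⧸ I ^ n • (⊤ : Submodule R M))
          (F.coneDRestrict hφ₀ m (k + 1))))
        (LinearMap.ker (LinearMap.lTensor (M ⧸ I ^ n • (⊤ : Submodule R M))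
          (F.coneDRestrict hφ₀ m k))) =
      relLength (S.quotientBoundaries k n m) (S.quotientCycles k n m) := by
  have hD (k z) : S.coneD k (F.coneInclusion M m (k + 1) z) =
      F.coneInclusion M m k (LinearMap.lTensor M (F.coneDRestrict hφ₀ m k) z) := by
    rw [coneInclusion_coneDRestrict, S.coneD_apply, hd, hd, hφ]
  have h₀ (k) : S.coneW k 0 m = LinearMap.range (F.coneInclusion M m k) := by
    rw [range_coneInclusion, FilteredSystem.coneW, hW, hW, pow_zero, one_smul, one_smul]
  have hn (k) : S.coneW k n m = (I ^ n • ⊤ : Submodule R _).map (F.coneInclusion M m k) := by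
    rw [Submodule.map_smul'', Submodule.map_top, range_coneInclusion, Submodule.ideal_smul_prod,
      FilteredSystem.coneW, hW, hW]
  have hB : S.quotientBoundaries k n m = (LinearMap.range (LinearMap.lTensor M
      (F.coneDRestrict hφ₀ m (k + 1))) ⊔ I ^ n • ⊤).map (F.coneInclusion M m (k + 1)) := by
    rw [Submodule.map_sup, ← hn, FilteredSystem.quotientBoundaries, FilteredSystem.coneBoundaries,
      h₀, ← LinearMap.range_comp, ← LinearMap.range_comp]
    congr 2
    exact LinearMap.ext (hD (k + 1))
  have hinj (k) := F.coneInclusion_injective M m k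
  rw [relLength_lTensor_quotient]
  refine relLength_congr (F.coneInclusion M m (k + 1)) ?_ ?_ ?_
  · refine fun z hz => ⟨by rw [h₀]; exact ⟨z, rfl⟩, ?_⟩
    change S.coneD k _ ∈ S.coneW k n m
    rw [hD, hn]
    exact Submodule.mem_map_of_mem hz
  · rintro z ⟨hz₁, hz₂⟩
    change S.coneD k z ∈ S.coneW k n m at hz₂
    rw [h₀] at hz₁
    obtain ⟨z, rfl⟩ := hz₁
    rw [hD, hn] at hz₂
    obtain ⟨w, hw, hwz⟩ := hz₂
    exact ⟨z, (hinj k hwz ▸ hw : LinearMap.lTensor M (F.coneDRestrict hφ₀ m k) z ∈ _),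
      by rw [sub_self]; exact zero_mem _⟩
  · intro z _
    rw [hB]
    exact (hinj (k + 1)).mem_set_image

end GradedResolution

end ConeHomology

section TorPolynomial

open TensorProduct MvPolynomial

theorem modLength_TorM_eq_zero_of_subsingleton {R : Type} [CommRing R] (A B : Type)
    [AddCommGroup A] [Module R A] [AddCommGroup B] [Module R B] [Subsingleton B] (i : ℕ) :
    modLength R (TorM R i A B) = 0 := by
  rw [modLength_TorM (P := fun _ => PUnit) A (fun _ => 0) (0 : PUnit →ₗ[R] B) inferInstance
    (fun b => ⟨0, Subsingleton.elim _ _⟩) (Subsingleton.elim _ _)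
    (fun _ => Subsingleton.elim _ _) i, relLength_eq_zero]
  rfl

theorem modLength_TorM_eq_relLength {R : Type} [CommRing R] {q : ℕ} {g : Fin q → R} {N : Type}
    [AddCommGroup N] [Module R N] (F : GradedResolution g N)
    {φ : ∀ k, (Fin (F.r k) → MvPolynomial (Fin q) R) →ₗ[R]
      (Fin (F.r k) → MvPolynomial (Fin q) R)}
    (hφ₀ : ∀ k v, gradedComponent (F.δ k) 0 (φ k v) = φ k v)
    (hφ : ∀ k v, F.aug k (φ k v) = F.aug k v)
    (hφd : ∀ k v, F.d k (φ (k + 1) v) = φ k (F.d k v)) (A : Type) [AddCommGroup A] [Module R A]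
    (m i : ℕ) :
    modLength R (TorM R i A (N ⧸ Ideal.span (Set.range g) ^ m • (⊤ : Submodule R N))) =
      relLength (LinearMap.range (LinearMap.lTensor A (F.coneDRestrict hφ₀ m (i + 2))))
        (LinearMap.ker (LinearMap.lTensor A (F.coneDRestrict hφ₀ m (i + 1)))) := by
  have h₁ := F.subsingleton 1 (by lia)
  have h₂ := F.subsingleton 2 (by lia)
  exact modLength_TorM (P := fun j => LinearMap.range (F.coneComponent m (j + 1))) A
    (fun j => F.coneDRestrict hφ₀ m (j + 1)) (F.coneAug m)
    ⟨fun x y => Subtype.ext (Prod.ext (Subsingleton.elim _ _) (Subsingleton.elim _ _))⟩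
    (F.coneAug_surjective m) (F.range_coneDRestrict_two hφ₀ hφ m)
    (F.range_coneDRestrict hφ₀ hφ hφd m) i

theorem eventuallyPolynomial₂_zero {f : ℕ → ℕ → WithBot ℕ∞} {k l : ℕ}
    (hf : ∀ m n, k ≤ m → l ≤ n → f m n = 0) : EventuallyPolynomial₂ f :=
  ⟨0, k, l, fun m hm n hn => ⟨0, hf m n hm hn, by rw [map_zero, Nat.cast_zero]⟩⟩

theorem subsingleton_quotient_top_pow_smul {R M : Type*} [CommRing R] [AddCommGroup M] [Module R M]
    (n : ℕ) : Subsingleton (M ⧸ ((⊤ : Ideal R) ^ n • (⊤ : Submodule R M))) := by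
  rw [Ideal.top_pow, Submodule.top_smul]
  infer_instance

theorem exists_span_range_eq {R : Type*} [CommRing R] [IsNoetherianRing R] (I : Ideal R) :
    ∃ (p : ℕ) (a : Fin p → R), Ideal.span (Set.range a) = I :=
  Submodule.fg_iff_exists_fin_generating_family.1 (IsNoetherian.noetherian I)

end TorPolynomial

theorem stmt4 (R : Type) [CommRing R] [IsNoetherianRing R] [IsLocalRing R]
    (I J : Ideal R)
    (M : Type) [AddCommGroup M] [Module R M] [Module.Finite R M]
    (N : Type) [AddCommGroup N] [Module R N] [Module.Finite R N]
    (i : ℕ)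
    (hfl : IsFiniteLength R (TensorProduct R M N)) :
    EventuallyPolynomial₂ (fun m n =>
      modLength R ↥(TorM R i (M ⧸ (I ^ n • (⊤ : Submodule R M)))
        (N ⧸ (J ^ m • (⊤ : Submodule R N))))) := by
  by_cases hJ : J = ⊤
  · subst hJ
    refine eventuallyPolynomial₂_zero (k := 0) (l := 0) fun m n _ _ => ?_
    have := subsingleton_quotient_top_pow_smul (R := R) (M := N) m
    exact modLength_TorM_eq_zero_of_subsingleton _ _ i
  obtain ⟨q, g, rfl⟩ := exists_span_range_eq J
  obtain ⟨F⟩ := GradedResolution.exists_of_finite g N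
  obtain ⟨φ, hφX, hφ₀, hφ, hφd⟩ := F.exists_evaluation
  by_cases hI : I = ⊤
  · subst hI
    refine eventuallyPolynomial₂_zero (k := 0) (l := 0) fun m n _ _ => ?_
    have := subsingleton_quotient_top_pow_smul (R := R) (M := M) n
    rw [modLength_TorM_eq_relLength F hφ₀ hφ hφd, relLength_eq_zero]
    rfl
  obtain ⟨p, a, rfl⟩ := exists_span_range_eq I
  obtain ⟨S, hSd, hSφ, hSW⟩ := F.exists_filteredSystem M a
    (fun j => le_maximalIdeal hI (Ideal.subset_span ⟨j, rfl⟩))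
    (fun j => le_maximalIdeal hJ (Ideal.subset_span ⟨j, rfl⟩)) hfl hφX hφ₀ hφd
  obtain ⟨f, hf, l, hl⟩ := S.agreesWithPolynomial i
  obtain ⟨P, k, hP⟩ := hf.swap
  refine ⟨P, l + k, l + k, fun m hm n hn => ⟨f n m, ?_, hP m n (by lia) (by lia)⟩⟩
  exact (modLength_TorM_eq_relLength F hφ₀ hφ hφd _ m i).trans (congrArg _
    ((F.relLength_lTensor_coneDRestrict M hφ₀ S hSd hSφ hSW (i + 1) n m).trans
      (hl n m (by lia) (by lia))))
end

section
/- Let (R,P) be a commutative Noetherian local ring, I an ideal of R, M and N finitely generated R-modules, and i ≥ 0 fixed. Then the following are equivalent: (a) I ⊆ rad(ann_R Tor_i^R(M,N)); (b) I ⊆ rad(ann_R Tor_i^R(I^k M, N)) for some k ≥ 0; (c) I ⊆ rad(ann_R Tor_i^R(I^n M, N)) for all n ≥ 0. -/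
open CategoryTheory IsLocalRing

namespace CategoryTheory

/-- Left deriving a scalar multiple of the identity gives the same multiple of the identity. -/
lemma NatTrans.leftDerived_app_eq_smul {R C D : Type*} [Semiring R] [Category* C] [Category* D]
    [Abelian C] [HasProjectiveResolutions C] [Abelian D] [Linear R D]
    (F : C ⥤ D) [F.Additive] (α : F ⟶ F) (r : R) (hα : ∀ X, α.app X = r • 𝟙 (F.obj X))
    (n : ℕ) (X : C) :
    (NatTrans.leftDerived α n).app X = r • 𝟙 ((F.leftDerived n).obj X) := by
  let P := projectiveResolution X
  have h : (NatTrans.mapHomologicalComplex α (ComplexShape.down ℕ)).app P.complex =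
      r • 𝟙 ((F.mapHomologicalComplex _).obj P.complex) := by
    ext j
    simp [hα]
    rfl
  have h' : (HomologicalComplex.homologyFunctor D (ComplexShape.down ℕ) n).map
      (r • 𝟙 ((F.mapHomologicalComplex _).obj P.complex)) = r • 𝟙 _ :=
    (ShortComplex.homologyMap_smul
      (𝟙 (((F.mapHomologicalComplex _).obj P.complex).sc n)) r).trans
      (by rw [ShortComplex.homologyMap_id]; rfl)
  rw [P.leftDerived_app_eq, h, h']
  simp

end CategoryTheory

section

variable {R : Type} [CommRing R] {L M N : Type} [AddCommGroup L] [Module R L]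
  [AddCommGroup M] [Module R M] [AddCommGroup N] [Module R N]

lemma tor_map_ofHom_smul_id_app_apply (i : ℕ) (r : R) (t : TorM R i M N) :
    (((Tor (ModuleCat R) i).map (ModuleCat.ofHom (r • (LinearMap.id : M →ₗ[R] M)))).app
      (ModuleCat.of R N)).hom t = r • t := by
  have h := NatTrans.leftDerived_app_eq_smul
    ((MonoidalCategory.tensoringLeft (ModuleCat R)).obj (ModuleCat.of R M))
    ((MonoidalCategory.tensoringLeft (ModuleCat R)).map
      (ModuleCat.ofHom (r • (LinearMap.id : M →ₗ[R] M)))) r (fun X ↦ by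
        have : ModuleCat.ofHom (r • (LinearMap.id : M →ₗ[R] M)) = r • CategoryStruct.id (ModuleCat.of R M) := rfl
        rw [this]
        simp) i (ModuleCat.of R N)
  exact congrArg (fun f ↦ f.hom t) h

/-- If multiplication by `a` on `M` factors through `L`, then `a * b` annihilates `Tor(M, N)`
whenever `b` annihilates `Tor(L, N)`. -/
lemma mul_mem_annihilator_torM (i : ℕ) {a b : R} (f : M →ₗ[R] L) (g : L →ₗ[R] M)
    (hgf : g ∘ₗ f = a • LinearMap.id) (hb : b ∈ Module.annihilator R (TorM R i L N)) :
    a * b ∈ Module.annihilator R (TorM R i M N) := by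
  rw [Module.mem_annihilator] at hb ⊢
  intro t
  let T := fun {X Y : ModuleCat R} (u : X ⟶ Y) ↦
    (((Tor (ModuleCat R) i).map u).app (ModuleCat.of R N)).hom
  have h : (T (ModuleCat.ofHom g)) (T (ModuleCat.ofHom f) (b • t)) = a • b • t := by
    rw [← tor_map_ofHom_smul_id_app_apply i a (b • t), ← hgf, ModuleCat.ofHom_comp,
      Functor.map_comp]
    rfl
  have h0 : T (ModuleCat.ofHom f) (b • t) = 0 :=
    ((T (ModuleCat.ofHom f)).map_smul b t).trans (hb (T (ModuleCat.ofHom f) t))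
  rw [mul_smul, ← h, h0, map_zero]
  rfl

/-- Maps between `L` and `M` whose composite on `M` is a power of `x` transfer membership of `x`
in the radical of the annihilator from `Tor(L, N)` to `Tor(M, N)`. -/
lemma mem_radical_annihilator_torM (i : ℕ) {x : R} {n : ℕ} (f : M →ₗ[R] L) (g : L →ₗ[R] M)
    (hgf : g ∘ₗ f = x ^ n • LinearMap.id)
    (hx : x ∈ (Module.annihilator R (TorM R i L N)).radical) :
    x ∈ (Module.annihilator R (TorM R i M N)).radical := by
  obtain ⟨s, hs⟩ := hx
  exact ⟨n + s, pow_add x n s ▸ mul_mem_annihilator_torM i f g hgf hs⟩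

lemma mem_radical_annihilator_torM_pow_smul_top_iff (I : Ideal R) (i n : ℕ) {x : R} (hx : x ∈ I) :
    x ∈ (Module.annihilator R (TorM R i ↥(I ^ n • (⊤ : Submodule R M)) N)).radical ↔
      x ∈ (Module.annihilator R (TorM R i M N)).radical := by
  let f : M →ₗ[R] ↥(I ^ n • (⊤ : Submodule R M)) :=
    (x ^ n • LinearMap.id).codRestrict _ fun _ ↦
      Submodule.smul_mem_smul (Ideal.pow_mem_pow hx n) Submodule.mem_top
  exact ⟨mem_radical_annihilator_torM i f (Submodule.subtype _) rfl,
    mem_radical_annihilator_torM i (Submodule.subtype _) f rfl⟩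

end

theorem stmt6 (R : Type) [CommRing R] [IsNoetherianRing R] [IsLocalRing R]
    (I : Ideal R)
    (M : Type) [AddCommGroup M] [Module R M] [Module.Finite R M]
    (N : Type) [AddCommGroup N] [Module R N] [Module.Finite R N]
    (i : ℕ) :
    List.TFAE
      [ I ≤ (Module.annihilator R ↥(TorM R i M N)).radical,
        ∃ k : ℕ, I ≤ (Module.annihilator R
          ↥(TorM R i (↥(I ^ k • (⊤ : Submodule R M))) N)).radical,
        ∀ n : ℕ, I ≤ (Module.annihilator R
          ↥(TorM R i (↥(I ^ n • (⊤ : Submodule R M))) N)).radical ] := by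
  tfae_have 1 → 3 := fun h n x hx ↦
    (mem_radical_annihilator_torM_pow_smul_top_iff I i n hx).2 (h hx)
  tfae_have 3 → 2 := fun h ↦ ⟨0, h 0⟩
  tfae_have 2 → 1 := fun ⟨k, h⟩ x hx ↦
    (mem_radical_annihilator_torM_pow_smul_top_iff I i k hx).1 (h hx)
  tfae_finish
end

section
/- Let R be a commutative Noetherian ring (not necessarily local) and J ⊆ R an ideal. Let S₁ = R[X₁,…,X_r] be the polynomial ring, graded by total degree, and let C : F₂ →ψ F₁ →φ F₀ be a complex of graded S₁-modules with degree-preserving S₁-linear maps, where F₁ and F₀ are finitely generated S₁-modules. Then there exist an integer l ≥ 0 and finitely generated graded S₁-submodules Z ⊆ U and W ⊆ V (all contained in a common graded S₁-module, with Z + J^{m−l}W ⊆ U + J^{m−l}V) such that for all m ≥ l, the first homology H₁(C ⊗_R R/J^m) is isomorphic as a graded S₁-module to (U + J^{m−l}V)/(Z + J^{m−l}W). -/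
/-- The quotient of a submodule `X` by (its intersection with) a submodule `Y`. -/
abbrev subQuot (S : Type) [CommRing S] (F : Type) [AddCommGroup F] [Module S F]
    (X Y : Submodule S F) : Type :=
  ↥X ⧸ Submodule.comap X.subtype Y

/-- The canonical projection onto `subQuot S F X Y`. -/
abbrev subQuotMk (S : Type) [CommRing S] (F : Type) [AddCommGroup F] [Module S F]
    (X Y : Submodule S F) : ↥X →ₗ[S] subQuot S F X Y :=
  Submodule.mkQ _

theorem span_homogeneous_eq {R S F : Type*} [CommRing R] [CommRing S] [AddCommGroup F]
    [Module R F] [Module S F] (ℱ : ℕ → Submodule R F) [DirectSum.Decomposition ℱ]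
    (N : Submodule S F) (hN : ∀ x ∈ N, ∀ n, (DirectSum.decompose ℱ x n : F) ∈ N) :
    ∃ s : Set F, (∀ x ∈ s, ∃ n, x ∈ ℱ n) ∧ N = Submodule.span S s := by
  classical
  refine ⟨{x | x ∈ N ∧ ∃ n, x ∈ ℱ n}, fun x hx => hx.2, le_antisymm (fun x hx => ?_)
    (Submodule.span_le.2 fun x hx => hx.1)⟩
  rw [← DirectSum.sum_support_decompose ℱ x]
  exact Submodule.sum_mem _ fun n _ =>
    Submodule.subset_span ⟨hN x hx n, n, SetLike.coe_mem _⟩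

theorem decompose_map_apply {R S F G : Type*} [CommRing R] [CommRing S]
    [AddCommGroup F] [Module R F] [Module S F] [AddCommGroup G] [Module R G] [Module S G]
    (ℱ : ℕ → Submodule R F) [DirectSum.Decomposition ℱ]
    (𝒢 : ℕ → Submodule R G) [DirectSum.Decomposition 𝒢]
    (f : F →ₗ[S] G) (hf : ∀ n, ∀ x ∈ ℱ n, f x ∈ 𝒢 n) (x : F) (n : ℕ) :
    (DirectSum.decompose 𝒢 (f x) n : G) = f (DirectSum.decompose ℱ x n) := by
  induction x using DirectSum.Decomposition.inductionOn ℱ with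
  | zero => simp
  | @homogeneous i y =>
    by_cases h : i = n
    · subst h
      rw [DirectSum.decompose_of_mem_same _ (hf _ _ y.2), DirectSum.decompose_of_mem_same _ y.2]
    · rw [DirectSum.decompose_of_mem_ne _ (hf _ _ y.2) h,
        DirectSum.decompose_of_mem_ne _ y.2 h, map_zero]
  | add y z hy hz => simp [DirectSum.decompose_add, hy, hz]

theorem map_mem_map_pow_smul_top {R S F : Type*} [CommRing R] [CommRing S] [Algebra R S]
    [AddCommGroup F] [Module R F] [Module S F] [IsScalarTower R S F]
    (I : Ideal R) (l : ℕ) (f : F →ₗ[R] F) (x : F)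
    (hx : x ∈ (I.map (algebraMap R S)) ^ l • (⊤ : Submodule S F)) :
    f x ∈ (I.map (algebraMap R S)) ^ l • (⊤ : Submodule S F) := by
  rw [← Ideal.map_pow, ← Submodule.restrictScalars_mem R, Ideal.smul_restrictScalars,
    Submodule.restrictScalars_top] at hx ⊢
  exact Submodule.smul_top_le_comap_smul_top _ f hx

theorem decompose_mem_map_pow_smul_top {R S F : Type*} [CommRing R] [CommRing S] [Algebra R S]
    [AddCommGroup F] [Module R F] [Module S F] [IsScalarTower R S F]
    (ℱ : ℕ → Submodule R F) [DirectSum.Decomposition ℱ] (I : Ideal R) (l : ℕ) (x : F)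
    (hx : x ∈ (I.map (algebraMap R S)) ^ l • (⊤ : Submodule S F)) (n : ℕ) :
    (DirectSum.decompose ℱ x n : F) ∈ (I.map (algebraMap R S)) ^ l • (⊤ : Submodule S F) :=
  map_mem_map_pow_smul_top I l ((ℱ n).subtype ∘ₗ DirectSum.component R ℕ (fun i => ℱ i) n ∘ₗ
    (DirectSum.decomposeLinearEquiv ℱ).toLinearMap) x hx

/-- The Artin–Rees lemma, in terms of preimages under a linear map. -/
theorem exists_comap_pow_smul_top_eq {S F G : Type*} [CommRing S] [IsNoetherianRing S]
    [AddCommGroup F] [Module S F] [AddCommGroup G] [Module S G] [Module.Finite S G]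
    (I : Ideal S) (f : F →ₗ[S] G) :
    ∃ l, ∀ m, l ≤ m → Submodule.comap f (I ^ m • (⊤ : Submodule S G)) =
      LinearMap.ker f ⊔ I ^ (m - l) • Submodule.comap f (I ^ l • (⊤ : Submodule S G)) := by
  obtain ⟨l, hl⟩ := I.exists_pow_inf_eq_pow_smul (LinearMap.range f)
  refine ⟨l, fun m hm => ?_⟩
  rw [sup_comm, ← Submodule.comap_map_eq, Submodule.map_smul'', Submodule.map_comap_eq,
    inf_comm, ← hl m hm, Submodule.comap_inf]
  rw [show Submodule.comap f (LinearMap.range f) = ⊤ from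
    LinearMap.range_le_iff_comap.1 le_rfl, inf_top_eq]

theorem exists_subQuot_equiv_of_eq {S F : Type} [CommRing S] [AddCommGroup F] [Module S F]
    {X Y X' Y' : Submodule S F} (hX : X = X') (hY : Y = Y') :
    ∃ e : subQuot S F X Y ≃ₗ[S] subQuot S F X' Y', ∀ A : Set F,
      (⇑e) '' ((⇑(subQuotMk S F X Y)) '' {x : ↥X | (x : F) ∈ A})
        = (⇑(subQuotMk S F X' Y')) '' {x : ↥X' | (x : F) ∈ A} := by
  subst hX hY
  exact ⟨LinearEquiv.refl S _, fun A => Set.image_id _⟩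

theorem stmt11 (R : Type) [CommRing R] [IsNoetherianRing R] (J : Ideal R) (r : ℕ)
    -- a complex `F₂ —ψ→ F₁ —φ→ F₀` of graded modules over `S₁ = R[X₁, …, X_r]`
    -- (graded by total degree), with degree-preserving `S₁`-linear maps,
    -- where `F₁` and `F₀` are finitely generated over `S₁`
    (F₂ F₁ F₀ : Type)
    [AddCommGroup F₂] [Module R F₂] [Module (MvPolynomial (Fin r) R) F₂]
    [IsScalarTower R (MvPolynomial (Fin r) R) F₂]
    [AddCommGroup F₁] [Module R F₁] [Module (MvPolynomial (Fin r) R) F₁]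
    [IsScalarTower R (MvPolynomial (Fin r) R) F₁]
    [AddCommGroup F₀] [Module R F₀] [Module (MvPolynomial (Fin r) R) F₀]
    [IsScalarTower R (MvPolynomial (Fin r) R) F₀]
    [Module.Finite (MvPolynomial (Fin r) R) F₁]
    [Module.Finite (MvPolynomial (Fin r) R) F₀]
    (ℱ₂ : ℕ → Submodule R F₂) (ℱ₁ : ℕ → Submodule R F₁) (ℱ₀ : ℕ → Submodule R F₀)
    (hdec₂ : DirectSum.IsInternal ℱ₂) (hdec₁ : DirectSum.IsInternal ℱ₁)
    (hdec₀ : DirectSum.IsInternal ℱ₀)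
    (hsmul₂ : ∀ (a b : ℕ) (p : MvPolynomial (Fin r) R) (x : F₂),
      p ∈ MvPolynomial.homogeneousSubmodule (Fin r) R a → x ∈ ℱ₂ b → p • x ∈ ℱ₂ (a + b))
    (hsmul₁ : ∀ (a b : ℕ) (p : MvPolynomial (Fin r) R) (x : F₁),
      p ∈ MvPolynomial.homogeneousSubmodule (Fin r) R a → x ∈ ℱ₁ b → p • x ∈ ℱ₁ (a + b))
    (hsmul₀ : ∀ (a b : ℕ) (p : MvPolynomial (Fin r) R) (x : F₀),
      p ∈ MvPolynomial.homogeneousSubmodule (Fin r) R a → x ∈ ℱ₀ b → p • x ∈ ℱ₀ (a + b))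
    (ψ : F₂ →ₗ[MvPolynomial (Fin r) R] F₁) (φ : F₁ →ₗ[MvPolynomial (Fin r) R] F₀)
    (hcomplex : φ.comp ψ = 0)
    (hψgr : ∀ (n : ℕ) (x : F₂), x ∈ ℱ₂ n → ψ x ∈ ℱ₁ n)
    (hφgr : ∀ (n : ℕ) (x : F₁), x ∈ ℱ₁ n → φ x ∈ ℱ₀ n) :
    -- conclusion: for some `l ≥ 0` there are finitely generated graded submodules
    -- `Z ⊆ U` and `W ⊆ V` of `F₁` such that for all `m ≥ l`,
    -- `H₁(C ⊗ R/J^m) = φ⁻¹(J^m F₀)/(im ψ + J^m F₁)` is isomorphic, as a graded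
    -- `S₁`-module, to `(U + J^{m-l} V)/(Z + J^{m-l} W)`
    ∃ (l : ℕ) (U V W Z : Submodule (MvPolynomial (Fin r) R) F₁),
      U.FG ∧ V.FG ∧ W.FG ∧ Z.FG ∧
      (∃ s : Set F₁, (∀ x ∈ s, ∃ n, x ∈ ℱ₁ n) ∧ U = Submodule.span _ s) ∧
      (∃ s : Set F₁, (∀ x ∈ s, ∃ n, x ∈ ℱ₁ n) ∧ V = Submodule.span _ s) ∧
      (∃ s : Set F₁, (∀ x ∈ s, ∃ n, x ∈ ℱ₁ n) ∧ W = Submodule.span _ s) ∧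
      (∃ s : Set F₁, (∀ x ∈ s, ∃ n, x ∈ ℱ₁ n) ∧ Z = Submodule.span _ s) ∧
      Z ≤ U ∧ W ≤ V ∧
      ∀ m, l ≤ m →
        ∃ X Y X' Y' : Submodule (MvPolynomial (Fin r) R) F₁,
          -- `X/Y` is the concrete presentation of `H₁(C ⊗ R/J^m)`:
          -- `ker(φ ⊗ R/J^m) = φ⁻¹(J^m F₀)/J^m F₁` and
          -- `im(ψ ⊗ R/J^m) = (im ψ + J^m F₁)/J^m F₁`
          X = Submodule.comap φ
              ((J.map (algebraMap R (MvPolynomial (Fin r) R))) ^ m •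
                (⊤ : Submodule (MvPolynomial (Fin r) R) F₀)) ∧
          Y = LinearMap.range ψ ⊔
              (J.map (algebraMap R (MvPolynomial (Fin r) R))) ^ m •
                (⊤ : Submodule (MvPolynomial (Fin r) R) F₁) ∧
          X' = U ⊔ (J.map (algebraMap R (MvPolynomial (Fin r) R))) ^ (m - l) • V ∧
          Y' = Z ⊔ (J.map (algebraMap R (MvPolynomial (Fin r) R))) ^ (m - l) • W ∧
          ∃ e : subQuot (MvPolynomial (Fin r) R) F₁ X Y ≃ₗ[MvPolynomial (Fin r) R]
              subQuot (MvPolynomial (Fin r) R) F₁ X' Y',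
            -- `e` is an isomorphism of *graded* modules: it carries the image of the
            -- degree-`n` homogeneous part onto the image of the degree-`n` part
            ∀ n : ℕ,
              (⇑e) '' ((⇑(subQuotMk (MvPolynomial (Fin r) R) F₁ X Y)) ''
                  {x : ↥X | (x : F₁) ∈ ℱ₁ n})
                = (⇑(subQuotMk (MvPolynomial (Fin r) R) F₁ X' Y')) ''
                  {x : ↥X' | (x : F₁) ∈ ℱ₁ n} := by
  let _ := hdec₂.chooseDecomposition
  let _ := hdec₁.chooseDecomposition
  let _ := hdec₀.chooseDecomposition
  obtain ⟨l, hl⟩ :=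
    exists_comap_pow_smul_top_eq (J.map (algebraMap R (MvPolynomial (Fin r) R))) φ
  refine ⟨l, LinearMap.ker φ,
    Submodule.comap φ ((J.map (algebraMap R (MvPolynomial (Fin r) R))) ^ l • ⊤),
    (J.map (algebraMap R (MvPolynomial (Fin r) R))) ^ l • ⊤, LinearMap.range ψ,
    IsNoetherian.noetherian _, IsNoetherian.noetherian _, IsNoetherian.noetherian _,
    IsNoetherian.noetherian _, span_homogeneous_eq ℱ₁ _ ?_, span_homogeneous_eq ℱ₁ _ ?_,
    span_homogeneous_eq ℱ₁ _ (decompose_mem_map_pow_smul_top ℱ₁ J l),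
    span_homogeneous_eq ℱ₁ _ ?_, LinearMap.range_le_ker_iff.2 hcomplex,
    Submodule.smul_top_le_comap_smul_top _ φ, fun m hm => ⟨_, _, _, _, rfl, rfl, rfl, rfl, ?_⟩⟩
  · intro x hx n
    rw [LinearMap.mem_ker] at hx ⊢
    rw [← decompose_map_apply ℱ₁ ℱ₀ φ hφgr, hx]
    simp
  · intro x hx n
    rw [Submodule.mem_comap] at hx ⊢
    rw [← decompose_map_apply ℱ₁ ℱ₀ φ hφgr]
    exact decompose_mem_map_pow_smul_top ℱ₀ J l _ hx n
  · rintro _ ⟨x, rfl⟩ n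
    rw [decompose_map_apply ℱ₂ ℱ₁ ψ hψgr]
    exact LinearMap.mem_range_self _ _
  · obtain ⟨e, he⟩ := exists_subQuot_equiv_of_eq (hl m hm)
      (show LinearMap.range ψ ⊔ (J.map (algebraMap R (MvPolynomial (Fin r) R))) ^ m • ⊤ =
        LinearMap.range ψ ⊔ (J.map (algebraMap R (MvPolynomial (Fin r) R))) ^ (m - l) •
          (J.map (algebraMap R (MvPolynomial (Fin r) R))) ^ l • ⊤ by
        rw [← Submodule.mul_smul, ← pow_add, Nat.sub_add_cancel hm])
    exact ⟨e, fun n => he (ℱ₁ n)⟩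
end
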